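/- There exists G ≥ 1 such that for every g ≥ G the inclusion 𝔪(6) ⊆ 𝔥(6) ∩ Ker ES is strict, i.e. 𝔪(6) ⊊ 𝔥(6) ∩ Ker ES. In particular, in degree 6 the Enomoto–Satoh trace (the 1-loop trace Tr̃₁) is not injective on the Johnson cokernel 𝔥(6)/𝔪(6). -/

import Mathlib

open TensorProduct

set_option maxSynthPendingDepth 4

noncomputable section

/-- The symplectic vector space `H = ℚ^{2g}`, with coordinates indexed so that
`aᵢ` corresponds to `Sum.inl i` and `bᵢ` to `Sum.inr i`. -/
abbrev Vs (g : ℕ) : Type := (Fin g ⊕ Fin g) → ℚ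

/-- The symplectic basis vector `aᵢ`. -/
def av (g : ℕ) (i : Fin g) : Vs g := Pi.single (Sum.inl i) 1

/-- The symplectic basis vector `bᵢ`. -/
def bv (g : ℕ) (i : Fin g) : Vs g := Pi.single (Sum.inr i) 1

/-- The coordinate functional. -/
def coordF (g : ℕ) (p : Fin g ⊕ Fin g) : Vs g →ₗ[ℚ] ℚ := LinearMap.proj p

/-- The symplectic form, with `(aᵢ·bⱼ) = δᵢⱼ` and `(aᵢ·aⱼ) = (bᵢ·bⱼ) = 0`. -/
def omegaF (g : ℕ) : Vs g →ₗ[ℚ] Vs g →ₗ[ℚ] ℚ :=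
  ∑ i : Fin g, ((coordF g (Sum.inl i)).smulRight (coordF g (Sum.inr i))
    - (coordF g (Sum.inr i)).smulRight (coordF g (Sum.inl i)))

/-- The tensor algebra `T = T(H)`. -/
abbrev TT (g : ℕ) : Type := TensorAlgebra ℚ (Vs g)

/-- The lower central series `L₁ = H`, `L_{n+1} = span{[x,y] : x ∈ H, y ∈ Lₙ}` of the
free Lie algebra inside `T`. -/
def LL (g : ℕ) : ℕ → Submodule ℚ (TT g)
  | 0 => ⊥
  | 1 => LinearMap.range (TensorAlgebra.ι ℚ (M := Vs g))
  | (n + 2) => Submodule.span ℚ {z | ∃ (x : Vs g), ∃ y ∈ LL g (n + 1),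
      z = TensorAlgebra.ι ℚ x * y - y * TensorAlgebra.ι ℚ x}

/-- Maps `H → T` with values in a given submodule. -/
def homInto (g : ℕ) (q : Submodule ℚ (TT g)) : Submodule ℚ (Vs g →ₗ[ℚ] TT g) where
  carrier := {f | ∀ x, f x ∈ q}
  add_mem' := by intro f₁ f₂ h₁ h₂ x; simpa using q.add_mem (h₁ x) (h₂ x)
  zero_mem' := by intro x; simp only [LinearMap.zero_apply]; exact q.zero_mem
  smul_mem' := by intro c f h x; simpa using q.smul_mem c (h x)

/-- The operator `z ↦ [z,c] = zc − cz`. -/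
def brkt (g : ℕ) (c : TT g) : TT g →ₗ[ℚ] TT g :=
  LinearMap.mulRight ℚ c - LinearMap.mulLeft ℚ c

/-- The linear map `f ↦ Σᵢ ([f(aᵢ),bᵢ] + [aᵢ,f(bᵢ)])` cutting out the symplectic
derivation condition. -/
def sympCond (g : ℕ) : (Vs g →ₗ[ℚ] TT g) →ₗ[ℚ] TT g :=
  ∑ i : Fin g,
    ((brkt g (TensorAlgebra.ι ℚ (bv g i))) ∘ₗ LinearMap.applyₗ (av g i)
      - (brkt g (TensorAlgebra.ι ℚ (av g i))) ∘ₗ LinearMap.applyₗ (bv g i))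

/-- The degree-`n` part `𝔥(n)` of the Lie algebra of positive symplectic derivations. -/
def hh (g n : ℕ) : Submodule ℚ (Vs g →ₗ[ℚ] TT g) :=
  homInto g (LL g (n + 1)) ⊓ LinearMap.ker (sympCond g)

/-- The linear map `v ↦ (ι v, f v)` into the trivial square-zero extension, whose lift
to the tensor algebra computes the unique derivation extending `f`. -/
def psiD' (g : ℕ) (f : Vs g →ₗ[ℚ] TT g) :
    Vs g →ₗ[ℚ] TrivSqZeroExt (TT g) (TT g) :=
  (TrivSqZeroExt.inlAlgHom ℚ (TT g) (TT g)).toLinearMap ∘ₗ TensorAlgebra.ι ℚ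
    + (TrivSqZeroExt.inrHom (TT g) (TT g)).restrictScalars ℚ ∘ₗ f

/-- The unique derivation `D_f` of `T` extending `f : H → T`. -/
def derOf (g : ℕ) (f : Vs g →ₗ[ℚ] TT g) : TT g →ₗ[ℚ] TT g :=
  (TrivSqZeroExt.sndHom (TT g) (TT g)).restrictScalars ℚ ∘ₗ
    (TensorAlgebra.lift ℚ (psiD' g f)).toLinearMap

/-- The bracket `[f,h] = D_f ∘ h − D_h ∘ f` of symplectic derivations. -/
def brkH (g : ℕ) (f h : Vs g →ₗ[ℚ] TT g) : Vs g →ₗ[ℚ] TT g :=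
  derOf g f ∘ₗ h - derOf g h ∘ₗ f

/-- The degree-6 part `𝔪(6)` of the image of the Johnson homomorphism: the span of
six-fold brackets of degree-one elements (Hain's theorem). -/
def mm6 (g : ℕ) : Submodule ℚ (Vs g →ₗ[ℚ] TT g) :=
  Submodule.span ℚ {f | ∃ f₁ ∈ hh g 1, ∃ f₂ ∈ hh g 1, ∃ f₃ ∈ hh g 1, ∃ f₄ ∈ hh g 1,
    ∃ f₅ ∈ hh g 1, ∃ f₆ ∈ hh g 1,
    f = brkH g (brkH g (brkH g (brkH g (brkH g f₁ f₂) f₃) f₄) f₅) f₆}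

/-- Splitting off the first tensor factor: `H^{⊗7} ≅ H ⊗ H^{⊗6}`. -/
def split7 (g : ℕ) : (⨂[ℚ]^7 (Vs g)) ≃ₗ[ℚ] Vs g ⊗[ℚ] (⨂[ℚ]^6 (Vs g)) :=
  (PiTensorProduct.reindex ℚ (fun _ : Fin 7 => Vs g)
      (finSumFinEquiv (m := 1) (n := 6)).symm).trans
    ((PiTensorProduct.tmulEquiv (ι := Fin 1) (ι₂ := Fin 6) ℚ (Vs g)).symm.trans
      (TensorProduct.congr (PiTensorProduct.subsingletonEquiv (0 : Fin 1))
        (LinearEquiv.refl ℚ _)))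

/-- The contraction `c(y ⊗ u₁⊗⋯⊗u₇) = (y·u₁) u₂⊗⋯⊗u₇` with `y` fixed. -/
def contrF (g : ℕ) (y : Vs g) : (⨂[ℚ]^7 (Vs g)) →ₗ[ℚ] ⨂[ℚ]^6 (Vs g) :=
  TensorProduct.lift ((LinearMap.lsmul ℚ (⨂[ℚ]^6 (Vs g))) ∘ₗ (omegaF g y)) ∘ₗ
    (split7 g).toLinearMap

/-- The degree-`n` component of the tensor algebra, as an element of `H^{⊗n}`. -/
def degComp (g n : ℕ) : TT g →ₗ[ℚ] ⨂[ℚ]^n (Vs g) :=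
  (DirectSum.component ℚ ℕ (fun i => ⨂[ℚ]^i (Vs g)) n) ∘ₗ
    (TensorAlgebra.toDirectSum (R := ℚ) (M := Vs g)).toLinearMap

/-- The cyclic shift `τ` of the tensor factors of `H^{⊗6}`. -/
def tauC (g : ℕ) : (⨂[ℚ]^6 (Vs g)) →ₗ[ℚ] ⨂[ℚ]^6 (Vs g) :=
  (PiTensorProduct.reindex ℚ (fun _ : Fin 6 => Vs g) (finRotate 6)).toLinearMap

/-- The reversal `ρ` of the tensor factors of `H^{⊗6}`. -/
def rhoC (g : ℕ) : (⨂[ℚ]^6 (Vs g)) →ₗ[ℚ] ⨂[ℚ]^6 (Vs g) :=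
  (PiTensorProduct.reindex ℚ (fun _ : Fin 6 => Vs g)
    (Fin.revPerm : Equiv.Perm (Fin 6))).toLinearMap

/-- The subspace `W ⊂ H^{⊗6}` spanned by all `x − τ(x)` and `x + ρ(x)`. -/
def Wsub (g : ℕ) : Submodule ℚ (⨂[ℚ]^6 (Vs g)) :=
  Submodule.span ℚ {z | (∃ x, z = x - tauC g x) ∨ (∃ x, z = x + rhoC g x)}

/-- The Enomoto–Satoh trace `f ↦ Σᵢ (c(aᵢ ⊗ f(bᵢ)) − c(bᵢ ⊗ f(aᵢ)))` into `H^{⊗6}/W`,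
defined on all of `Hom(H, T)`; the trace `ES` of the statement is its restriction
to `𝔥(6)`. -/
def ESfull (g : ℕ) : (Vs g →ₗ[ℚ] TT g) →ₗ[ℚ] ((⨂[ℚ]^6 (Vs g)) ⧸ Wsub g) :=
  (Wsub g).mkQ ∘ₗ
    (∑ i : Fin g,
      ((contrF g (av g i)) ∘ₗ degComp g 7 ∘ₗ LinearMap.applyₗ (bv g i)
        - (contrF g (bv g i)) ∘ₗ degComp g 7 ∘ₗ LinearMap.applyₗ (av g i)))

/-- `𝔥(6) ∩ Ker ES`. -/
def kerES (g : ℕ) : Submodule ℚ (Vs g →ₗ[ℚ] TT g) :=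
  hh g 6 ⊓ LinearMap.ker (ESfull g)

/-! ### Derivations of the tensor algebra -/

theorem derOf_ι (g : ℕ) (f : Vs g →ₗ[ℚ] TT g) (v : Vs g) :
    derOf g f (TensorAlgebra.ι ℚ v) = f v := by
  simp [derOf, psiD']

theorem fst_lift_psiD' (g : ℕ) (f : Vs g →ₗ[ℚ] TT g) (u : TT g) :
    (TensorAlgebra.lift ℚ (psiD' g f) u).fst = u := by
  have h : (TrivSqZeroExt.fstHom ℚ (TT g) (TT g)).comp (TensorAlgebra.lift ℚ (psiD' g f))
      = AlgHom.id ℚ (TT g) := by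
    ext v
    simp [psiD']
  exact DFunLike.congr_fun h u

theorem derOf_mul (g : ℕ) (f : Vs g →ₗ[ℚ] TT g) (u v : TT g) :
    derOf g f (u * v) = u * derOf g f v + derOf g f u * v := by
  simp [derOf, fst_lift_psiD']

theorem derOf_algebraMap (g : ℕ) (f : Vs g →ₗ[ℚ] TT g) (c : ℚ) :
    derOf g f (algebraMap ℚ (TT g) c) = 0 := by
  simp [derOf, TrivSqZeroExt.algebraMap_eq_inl']

theorem derOf_brkH (g : ℕ) (f h : Vs g →ₗ[ℚ] TT g) (u : TT g) :
    derOf g (brkH g f h) u = derOf g f (derOf g h u) - derOf g h (derOf g f u) := by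
  induction u using TensorAlgebra.induction with
  | algebraMap c => simp [derOf_algebraMap]
  | ι v => simp [derOf_ι, brkH]
  | mul u v hu hv => simp only [derOf_mul, hu, hv, map_add]; noncomm_ring
  | add u v hu hv => simp only [map_add, hu, hv]; abel

/-! ### The free Lie algebra -/

theorem ι_mem_LL (g : ℕ) (v : Vs g) : TensorAlgebra.ι ℚ v ∈ LL g 1 := ⟨v, rfl⟩

/-- Induction principle for `L_{n+2}`. -/
theorem LL_induction (g n : ℕ) {q : Submodule ℚ (TT g)}
    (h : ∀ x : Vs g, ∀ y ∈ LL g (n + 1),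
      TensorAlgebra.ι ℚ x * y - y * TensorAlgebra.ι ℚ x ∈ q) : LL g (n + 2) ≤ q := by
  change Submodule.span ℚ _ ≤ q
  rw [Submodule.span_le]
  rintro _ ⟨x, y, hy, rfl⟩
  exact h x y hy

theorem ι_brk_mem_LL (g n : ℕ) (v : Vs g) {y : TT g} (hy : y ∈ LL g n) :
    TensorAlgebra.ι ℚ v * y - y * TensorAlgebra.ι ℚ v ∈ LL g (n + 1) := by
  cases n with
  | zero => obtain rfl : y = 0 := hy; simp
  | succ n => exact Submodule.subset_span ⟨v, y, hy, rfl⟩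

theorem brk_mem_LL (g m n : ℕ) {x y : TT g} (hx : x ∈ LL g m) (hy : y ∈ LL g n) :
    x * y - y * x ∈ LL g (m + n) := by
  induction m generalizing n x y with
  | zero => obtain rfl : x = 0 := hx; simp
  | succ m ih =>
    cases m with
    | zero =>
      obtain ⟨v, rfl⟩ := hx
      rw [zero_add, add_comm]
      exact ι_brk_mem_LL g n v hy
    | succ m =>
      let q : Submodule ℚ (TT g) := (LL g (m + 2 + n)).comap (brkt g y)
      suffices h : LL g (m + 2) ≤ q from h hx
      refine LL_induction g m fun v z hz => ?_
      have h₁ : TensorAlgebra.ι ℚ v * (z * y - y * z) - (z * y - y * z) * TensorAlgebra.ι ℚ v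
          ∈ LL g (m + 1 + n + 1) := ι_brk_mem_LL g _ v (ih n hz hy)
      have h₂ := ih (n + 1) hz (ι_brk_mem_LL g n v hy)
      rw [show m + 1 + n + 1 = m + 2 + n by ring] at h₁
      rw [show m + 1 + (n + 1) = m + 2 + n by ring] at h₂
      have h₃ := sub_mem h₁ h₂
      change _ * y - y * _ ∈ LL g (m + 2 + n)
      convert h₃ using 1
      noncomm_ring

theorem derOf_mem_LL (g m n : ℕ) {f : Vs g →ₗ[ℚ] TT g} (hf : f ∈ homInto g (LL g (n + 1)))
    {z : TT g} (hz : z ∈ LL g m) : derOf g f z ∈ LL g (m + n) := by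
  induction m generalizing z with
  | zero => obtain rfl : z = 0 := hz; simp
  | succ m ih =>
    cases m with
    | zero =>
      obtain ⟨v, rfl⟩ := hz
      rw [derOf_ι, zero_add, add_comm]
      exact hf v
    | succ m =>
      suffices h : LL g (m + 2) ≤ (LL g (m + 2 + n)).comap (derOf g f) from h hz
      refine LL_induction g m fun v y hy => ?_
      have h₁ := brk_mem_LL g _ _ (hf v) hy
      have h₂ := ι_brk_mem_LL g _ v (ih hy)
      rw [show n + 1 + (m + 1) = m + 2 + n by ring] at h₁
      rw [show m + 1 + n + 1 = m + 2 + n by ring] at h₂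
      have h₃ := add_mem h₁ h₂
      change derOf g f _ ∈ LL g (m + 2 + n)
      convert h₃ using 1
      rw [map_sub, derOf_mul, derOf_mul, derOf_ι]
      abel

/-- The symplectic condition says that `D_f` kills `Σ [aᵢ,bᵢ]`. -/
theorem sympCond_eq_derOf (g : ℕ) (f : Vs g →ₗ[ℚ] TT g) :
    sympCond g f = derOf g f (∑ i : Fin g,
      (TensorAlgebra.ι ℚ (av g i) * TensorAlgebra.ι ℚ (bv g i)
        - TensorAlgebra.ι ℚ (bv g i) * TensorAlgebra.ι ℚ (av g i))) := by
  simp only [sympCond, LinearMap.sum_apply, map_sum]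
  refine Finset.sum_congr rfl fun i _ => ?_
  simp [brkt, derOf_mul, derOf_ι]
  abel

theorem brkH_mem_hh (g m n : ℕ) {f h : Vs g →ₗ[ℚ] TT g} (hf : f ∈ hh g m) (hh' : h ∈ hh g n) :
    brkH g f h ∈ hh g (m + n) := by
  obtain ⟨hf₁, hf₂⟩ := hf
  obtain ⟨hh₁, hh₂⟩ := hh'
  rw [SetLike.mem_coe, LinearMap.mem_ker, sympCond_eq_derOf] at hf₂ hh₂
  refine ⟨fun x => ?_, ?_⟩
  · have h₁ := derOf_mem_LL g (n + 1) m hf₁ (hh₁ x)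
    have h₂ := derOf_mem_LL g (m + 1) n hh₁ (hf₁ x)
    rw [show n + 1 + m = m + n + 1 by ring] at h₁
    rw [show m + 1 + n = m + n + 1 by ring] at h₂
    exact sub_mem h₁ h₂
  · rw [SetLike.mem_coe, LinearMap.mem_ker, sympCond_eq_derOf, derOf_brkH, hf₂, hh₂]
    simp

/-! ### Letters and removal of the first letter -/

/-- The set of letters, indexing the basis `a₁,…,a_g,b₁,…,b_g` of `H`. -/
abbrev Ltr (g : ℕ) : Type := Fin g ⊕ Fin g

/-- The basis vector of `H` indexed by a letter. -/
def bas (g : ℕ) (p : Ltr g) : Vs g := Pi.single p 1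

/-- A letter as an element of the tensor algebra. -/
def ltr (g : ℕ) (p : Ltr g) : TT g := TensorAlgebra.ι ℚ (bas g p)

theorem bas_apply (g : ℕ) (p q : Ltr g) : bas g p q = if q = p then 1 else 0 := by
  simp [bas, Pi.single_apply]

theorem ι_eq_sum (g : ℕ) (v : Vs g) : TensorAlgebra.ι ℚ v = ∑ p, v p • ltr g p := by
  conv_lhs => rw [pi_eq_sum_univ' v]
  simp only [map_sum, map_smul]
  refine Finset.sum_congr rfl fun p _ => ?_
  congr 2

/-- The augmentation of the tensor algebra. -/
abbrev aug (g : ℕ) : TT g →ₐ[ℚ] ℚ := TensorAlgebra.algebraMapInv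

theorem aug_ι (g : ℕ) (v : Vs g) : aug g (TensorAlgebra.ι ℚ v) = 0 := by
  simp [TensorAlgebra.algebraMapInv]

theorem aug_ltr (g : ℕ) (p : Ltr g) : aug g (ltr g p) = 0 := aug_ι g _

/-- The generator map of the algebra homomorphism `u ↦ !![ε(u), d_p(u); 0, u]`. -/
def fstRemGen (g : ℕ) (p : Ltr g) : Vs g →ₗ[ℚ] Matrix (Fin 2) (Fin 2) (TT g) where
  toFun v := !![0, algebraMap ℚ (TT g) (v p); 0, TensorAlgebra.ι ℚ v]
  map_add' v w := by ext i j; fin_cases i <;> fin_cases j <;> simp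
  map_smul' c v := by ext i j; fin_cases i <;> fin_cases j <;> simp [← Algebra.smul_def]

/-- The operator `d_p` keeping the words whose first letter is `p` and removing that letter. -/
def fstRem (g : ℕ) (p : Ltr g) : TT g →ₗ[ℚ] TT g where
  toFun u := TensorAlgebra.lift ℚ (fstRemGen g p) u 0 1
  map_add' u v := by simp
  map_smul' c u := by simp

theorem lift_fstRemGen (g : ℕ) (p : Ltr g) (u : TT g) :
    TensorAlgebra.lift ℚ (fstRemGen g p) u
      = !![algebraMap ℚ (TT g) (aug g u), fstRem g p u; 0, u] := by
  suffices h : TensorAlgebra.lift ℚ (fstRemGen g p) u 0 0 = algebraMap ℚ (TT g) (aug g u)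
      ∧ TensorAlgebra.lift ℚ (fstRemGen g p) u 1 0 = 0
      ∧ TensorAlgebra.lift ℚ (fstRemGen g p) u 1 1 = u by
    ext i j; fin_cases i <;> fin_cases j <;> simp [h, fstRem]
  induction u using TensorAlgebra.induction with
  | algebraMap c => simp [Matrix.algebraMap_matrix_apply]
  | ι v => simp [fstRemGen, aug_ι]
  | mul u v hu hv => simp [Matrix.mul_apply, hu, hv]
  | add u v hu hv => simp [hu, hv]

theorem fstRem_mul (g : ℕ) (p : Ltr g) (u v : TT g) :
    fstRem g p (u * v) = fstRem g p u * v + aug g u • fstRem g p v := by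
  have h : fstRem g p (u * v) = TensorAlgebra.lift ℚ (fstRemGen g p) (u * v) 0 1 := rfl
  rw [h, map_mul, lift_fstRemGen, lift_fstRemGen]
  simp [Matrix.mul_apply, Algebra.smul_def, add_comm]

theorem fstRem_algebraMap (g : ℕ) (p : Ltr g) (c : ℚ) :
    fstRem g p (algebraMap ℚ (TT g) c) = 0 := by
  simp [fstRem, Matrix.algebraMap_matrix_apply]

theorem fstRem_ι (g : ℕ) (p : Ltr g) (v : Vs g) :
    fstRem g p (TensorAlgebra.ι ℚ v) = algebraMap ℚ (TT g) (v p) := by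
  simp [fstRem, fstRemGen]

theorem fstRem_ltr (g : ℕ) (p q : Ltr g) :
    fstRem g p (ltr g q) = if p = q then 1 else 0 := by
  rw [ltr, fstRem_ι, bas_apply]
  split_ifs <;> simp

theorem fstRem_ltr_mul (g : ℕ) (p q : Ltr g) (u : TT g) :
    fstRem g p (ltr g q * u) = if p = q then u else 0 := by
  rw [fstRem_mul, fstRem_ltr, aug_ltr]
  split_ifs <;> simp

/-- Decomposition of a tensor according to the first letter. -/
theorem eq_aug_add_sum (g : ℕ) (u : TT g) :
    u = algebraMap ℚ (TT g) (aug g u) + ∑ p, ltr g p * fstRem g p u := by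
  induction u using TensorAlgebra.induction with
  | algebraMap c => simp [fstRem_algebraMap]
  | ι v =>
    simp only [aug_ι, map_zero, zero_add, fstRem_ι]
    rw [ι_eq_sum]
    refine Finset.sum_congr rfl fun p _ => ?_
    rw [Algebra.smul_def, Algebra.commutes]
  | mul u v hu hv =>
    simp only [fstRem_mul, map_mul, mul_add, Finset.sum_add_distrib, mul_smul_comm,
      ← mul_assoc, ← Finset.sum_mul, ← Finset.smul_sum]
    have h : u * v = algebraMap ℚ (TT g) (aug g u) * v + (∑ p, ltr g p * fstRem g p u) * v := by
      rw [← add_mul, ← hu]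
    have h' : algebraMap ℚ (TT g) (aug g u) * v
        = algebraMap ℚ (TT g) (aug g u) * algebraMap ℚ (TT g) (aug g v)
          + aug g u • ∑ p, ltr g p * fstRem g p v := by
      conv_lhs => rw [hv]
      rw [mul_add, Algebra.smul_def]
    rw [h, h']
    abel
  | add u v hu hv =>
    simp only [map_add, mul_add, Finset.sum_add_distrib]
    conv_lhs => rw [hu, hv]
    abel

/-- The coefficient of a word in a tensor. -/
def coef (g : ℕ) : List (Ltr g) → (TT g →ₗ[ℚ] ℚ)
  | [] => (aug g).toLinearMap
  | p :: w => coef g w ∘ₗ fstRem g p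

theorem coef_nil (g : ℕ) (u : TT g) : coef g [] u = aug g u := rfl

theorem coef_cons (g : ℕ) (p : Ltr g) (w : List (Ltr g)) (u : TT g) :
    coef g (p :: w) u = coef g w (fstRem g p u) := rfl

theorem coef_append_ltr (g : ℕ) (w : List (Ltr g)) (p q : Ltr g) (u : TT g) :
    coef g (w ++ [p]) (u * ltr g q) = if p = q then coef g w u else 0 := by
  induction w generalizing u with
  | nil =>
    simp only [List.nil_append, coef_cons, coef_nil, fstRem_mul, fstRem_ltr, map_add, map_mul,
      aug_ltr, map_smul]
    split_ifs <;> simp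
  | cons r w ih =>
    rw [List.cons_append, coef_cons, fstRem_mul, map_add, ih, fstRem_ltr]
    cases w with
    | nil =>
      rw [coef_cons]
      split_ifs <;>
      simp [coef_cons, coef_nil, fstRem_algebraMap, ← map_one (algebraMap ℚ (TT g)), -map_one]
    | cons s w =>
      rw [coef_cons]
      split_ifs <;>
      simp [coef_cons, fstRem_algebraMap, ← map_one (algebraMap ℚ (TT g)), -map_one]

/-! ### The commutator subspace -/

/-- The span of all commutators, which is generated by commutators with letters. -/
def commSub (g : ℕ) : Submodule ℚ (TT g) :=
  Submodule.span ℚ {z | ∃ p, ∃ u : TT g, z = ltr g p * u - u * ltr g p}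

theorem ι_mul_sub_mem_comm (g : ℕ) (x : Vs g) (v : TT g) :
    TensorAlgebra.ι ℚ x * v - v * TensorAlgebra.ι ℚ x ∈ commSub g := by
  rw [ι_eq_sum, Finset.sum_mul, Finset.mul_sum, ← Finset.sum_sub_distrib]
  refine sum_mem fun p _ => ?_
  rw [smul_mul_assoc, mul_smul_comm, ← smul_sub]
  exact Submodule.smul_mem _ _ (Submodule.subset_span ⟨p, v, rfl⟩)

theorem mul_sub_mul_mem_comm (g : ℕ) (u v : TT g) : u * v - v * u ∈ commSub g := by
  induction u using TensorAlgebra.induction generalizing v with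
  | algebraMap c => rw [Algebra.commutes, sub_self]; exact zero_mem _
  | ι x => exact ι_mul_sub_mem_comm g x v
  | mul u w hu hw =>
    have h := add_mem (hu (w * v)) (hw (v * u))
    convert h using 1
    noncomm_ring
  | add u w hu hw =>
    have h := add_mem (hu v) (hw v)
    convert h using 1
    noncomm_ring

theorem LL_le_comm (g n : ℕ) : LL g (n + 2) ≤ commSub g :=
  LL_induction g n fun x y _ => ι_mul_sub_mem_comm g x y

theorem derOf_mem_comm (g : ℕ) (f : Vs g →ₗ[ℚ] TT g) {z : TT g} (hz : z ∈ commSub g) :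
    derOf g f z ∈ commSub g := by
  suffices h : commSub g ≤ (commSub g).comap (derOf g f) from h hz
  refine Submodule.span_le.2 ?_
  rintro _ ⟨p, u, rfl⟩
  have h := add_mem (mul_sub_mul_mem_comm g (ltr g p) (derOf g f u))
    (mul_sub_mul_mem_comm g (derOf g f (ltr g p)) u)
  change derOf g f _ ∈ commSub g
  convert h using 1
  rw [map_sub, derOf_mul, derOf_mul]
  abel

/-! ### The divergence -/

/-- The divergence `Σ_p d_p(f(x_p))`, whose class is the Enomoto–Satoh trace. -/
def dvg (g : ℕ) (f : Vs g →ₗ[ℚ] TT g) : TT g := ∑ p, fstRem g p (f (bas g p))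

theorem fstRem_derOf (g : ℕ) {f : Vs g →ₗ[ℚ] TT g} (hf : ∀ v, aug g (f v) = 0)
    (p : Ltr g) (u : TT g) :
    fstRem g p (derOf g f u)
      = ∑ q, fstRem g p (f (bas g q)) * fstRem g q u + derOf g f (fstRem g p u) := by
  conv_lhs => rw [eq_aug_add_sum g u]
  simp only [map_add, derOf_algebraMap, map_sum, derOf_mul, ltr, derOf_ι, zero_add]
  simp only [fstRem_mul, hf, zero_smul, add_zero, fstRem_ι, aug_ι, Finset.sum_add_distrib]
  rw [add_comm]
  congr 1
  simp [bas_apply]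

theorem aug_of_mem_LL (g n : ℕ) {z : TT g} (hz : z ∈ LL g n) : aug g z = 0 := by
  match n with
  | 0 => obtain rfl : z = 0 := hz; simp
  | 1 => obtain ⟨v, rfl⟩ := hz; exact aug_ι g v
  | n + 2 =>
    suffices h : LL g (n + 2) ≤ LinearMap.ker (aug g).toLinearMap from h hz
    refine LL_induction g n fun x y _ => ?_
    simp [mul_comm]

theorem dvg_brkH (g : ℕ) {f h : Vs g →ₗ[ℚ] TT g} (hf : ∀ v, aug g (f v) = 0)
    (hh : ∀ v, aug g (h v) = 0) :
    dvg g (brkH g f h) - (derOf g f (dvg g h) - derOf g h (dvg g f)) ∈ commSub g := by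
  have h₁ : dvg g (brkH g f h) - (derOf g f (dvg g h) - derOf g h (dvg g f))
      = ∑ p, ∑ q, (fstRem g p (f (bas g q)) * fstRem g q (h (bas g p))
          - fstRem g q (h (bas g p)) * fstRem g p (f (bas g q))) := by
    simp only [dvg, brkH, LinearMap.sub_apply, LinearMap.comp_apply, map_sub, fstRem_derOf g hf,
      fstRem_derOf g hh, Finset.sum_sub_distrib, Finset.sum_add_distrib, map_sum]
    rw [Finset.sum_comm (f := fun p q => fstRem g p (h (bas g q)) * fstRem g q (f (bas g p)))]
    abel
  rw [h₁]
  exact sum_mem fun p _ => sum_mem fun q _ => mul_sub_mul_mem_comm g _ _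

theorem dvg_mem_range_ι (g : ℕ) {f : Vs g →ₗ[ℚ] TT g} (hf : f ∈ hh g 1) :
    dvg g f ∈ LL g 1 := by
  refine sum_mem fun p _ => ?_
  suffices h : LL g 2 ≤ (LL g 1).comap (fstRem g p) from h (hf.1 _)
  refine LL_induction g 0 ?_
  rintro x _ ⟨y, rfl⟩
  change fstRem g p _ ∈ LL g 1
  rw [map_sub, fstRem_mul, fstRem_mul, aug_ι, aug_ι, fstRem_ι, fstRem_ι, ← Algebra.smul_def,
    ← Algebra.smul_def, zero_smul, zero_smul, add_zero, add_zero]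
  exact sub_mem (Submodule.smul_mem _ _ (ι_mem_LL g y)) (Submodule.smul_mem _ _ (ι_mem_LL g x))

/-- Bracketing with a degree-one derivation lands in divergence zero modulo commutators. -/
theorem dvg_brkH_mem_comm (g n : ℕ) {f t : Vs g →ₗ[ℚ] TT g} (hf : f ∈ hh g (n + 1))
    (ht : t ∈ hh g 1) (hd : dvg g f ∈ LL g 1 ⊔ commSub g) : dvg g (brkH g f t) ∈ commSub g := by
  have h := dvg_brkH g (fun v => aug_of_mem_LL g _ (hf.1 v)) (fun v => aug_of_mem_LL g _ (ht.1 v))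
  have h₁ : derOf g f (dvg g t) ∈ commSub g := by
    have h₁ := derOf_mem_LL g 1 (n + 1) hf.1 (dvg_mem_range_ι g ht)
    rw [show 1 + (n + 1) = n + 2 by ring] at h₁
    exact LL_le_comm g _ h₁
  have h₂ : derOf g t (dvg g f) ∈ commSub g := by
    obtain ⟨y, hy, z, hz, hyz⟩ := Submodule.mem_sup.1 hd
    rw [← hyz, map_add]
    exact add_mem (LL_le_comm g 0 (derOf_mem_LL g 1 1 ht.1 hy)) (derOf_mem_comm g t hz)
  simpa using add_mem h (sub_mem h₁ h₂)

/-! ### Words and the Enomoto–Satoh trace -/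

/-- The monomial of the tensor algebra given by a word. -/
def word (g : ℕ) (w : List (Ltr g)) : TT g := (w.map (ltr g)).prod

theorem word_cons (g : ℕ) (p : Ltr g) (w : List (Ltr g)) :
    word g (p :: w) = ltr g p * word g w := by
  simp [word]

theorem word_append (g : ℕ) (v w : List (Ltr g)) : word g (v ++ w) = word g v * word g w := by
  simp [word]

theorem mem_span_word (g : ℕ) (u : TT g) : u ∈ Submodule.span ℚ (Set.range (word g)) := by
  induction u using TensorAlgebra.induction with
  | algebraMap c =>
    rw [Algebra.algebraMap_eq_smul_one]
    exact Submodule.smul_mem _ _ (Submodule.subset_span ⟨[], rfl⟩)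
  | ι v =>
    rw [ι_eq_sum]
    exact sum_mem fun p _ => Submodule.smul_mem _ _ (Submodule.subset_span ⟨[p], by simp [word]⟩)
  | mul u v hu hv =>
    have h := Submodule.mul_mem_mul hu hv
    rw [Submodule.span_mul_span] at h
    refine Submodule.span_mono ?_ h
    rintro _ ⟨_, ⟨v, rfl⟩, _, ⟨w, rfl⟩, rfl⟩
    exact ⟨v ++ w, word_append g v w⟩
  | add u v hu hv => exact add_mem hu hv

theorem linearMap_ext_word (g : ℕ) {M : Type*} [AddCommGroup M] [Module ℚ M]
    {φ ψ : TT g →ₗ[ℚ] M} (h : ∀ w, φ (word g w) = ψ (word g w)) : φ = ψ := by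
  ext1 u
  have hs := mem_span_word g u
  induction hs using Submodule.span_induction with
  | mem x hx => obtain ⟨w, rfl⟩ := hx; exact h w
  | zero => simp
  | add x y _ _ hx hy => simp [hx, hy]
  | smul c x _ hx => simp [hx]

theorem toDirectSum_word (g : ℕ) (w : List (Ltr g)) :
    TensorAlgebra.toDirectSum (word g w) = DirectSum.of (fun n => ⨂[ℚ]^n (Vs g)) w.length
      (PiTensorProduct.tprod ℚ fun i => bas g (w.get i)) := by
  rw [← TensorAlgebra.toDirectSum_tensorPower_tprod, TensorAlgebra.tprod_apply]
  congr 1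
  rw [word]
  congr 1
  conv_lhs => rw [← List.ofFn_get w, List.map_ofFn]
  rfl

theorem degComp_word (g : ℕ) (w : List (Ltr g)) :
    degComp g w.length (word g w) = PiTensorProduct.tprod ℚ fun i => bas g (w.get i) := by
  simp only [degComp, LinearMap.comp_apply, AlgHom.toLinearMap_apply, toDirectSum_word]
  exact DFinsupp.single_eq_same

theorem degComp_word_of_ne (g n : ℕ) (w : List (Ltr g)) (h : w.length ≠ n) :
    degComp g n (word g w) = 0 := by
  simp only [degComp, LinearMap.comp_apply, AlgHom.toLinearMap_apply, toDirectSum_word]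
  exact DFinsupp.single_eq_of_ne h.symm

theorem degComp_word_rotate (g : ℕ) (p : Ltr g) (w : List (Ltr g)) :
    tauC g (degComp g 6 (word g (w ++ [p]))) = degComp g 6 (word g (p :: w)) := by
  by_cases hw : w.length = 5
  · obtain ⟨a, b, c, d, e, rfl⟩ : ∃ a b c d e, w = [a, b, c, d, e] := by
      match w, hw with
      | [a, b, c, d, e], _ => exact ⟨a, b, c, d, e, rfl⟩
    have h₁ := degComp_word g ([a, b, c, d, e] ++ [p])
    have h₂ := degComp_word g (p :: [a, b, c, d, e])
    simp only [List.cons_append, List.nil_append, List.length_cons, List.length_nil] at h₁ h₂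
    erw [h₁, h₂]
    simp only [tauC, LinearEquiv.coe_coe]
    erw [PiTensorProduct.reindex_tprod]
    congr 1
    funext i
    fin_cases i <;> rfl
  · rw [degComp_word_of_ne, degComp_word_of_ne, map_zero] <;> simpa using hw

theorem degComp_word_reverse (g : ℕ) (w : List (Ltr g)) :
    rhoC g (degComp g 6 (word g w)) = degComp g 6 (word g w.reverse) := by
  by_cases hw : w.length = 6
  · obtain ⟨a, b, c, d, e, p, rfl⟩ : ∃ a b c d e p, w = [a, b, c, d, e, p] := by
      match w, hw with
      | [a, b, c, d, e, p], _ => exact ⟨a, b, c, d, e, p, rfl⟩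
    have h₁ := degComp_word g [a, b, c, d, e, p]
    have h₂ := degComp_word g [p, e, d, c, b, a]
    simp only [List.length_cons, List.length_nil] at h₁ h₂
    erw [h₁, h₂]
    simp only [rhoC, LinearEquiv.coe_coe]
    erw [PiTensorProduct.reindex_tprod]
    congr 1
    funext i
    fin_cases i <;> rfl
  · rw [degComp_word_of_ne, degComp_word_of_ne, map_zero] <;> simpa using hw

theorem contrF_word (g : ℕ) (y : Vs g) (q : Ltr g) (w : List (Ltr g)) :
    contrF g y (degComp g 7 (word g (q :: w))) = omegaF g y (bas g q) • degComp g 6 (word g w) := by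
  by_cases hw : w.length = 6
  · obtain ⟨a, b, c, d, e, p, rfl⟩ : ∃ a b c d e p, w = [a, b, c, d, e, p] := by
      match w, hw with
      | [a, b, c, d, e, p], _ => exact ⟨a, b, c, d, e, p, rfl⟩
    have h₁ := degComp_word g [q, a, b, c, d, e, p]
    have h₂ := degComp_word g [a, b, c, d, e, p]
    simp only [List.length_cons, List.length_nil] at h₁ h₂
    erw [h₁, h₂]
    simp only [contrF, split7, LinearMap.comp_apply, LinearEquiv.coe_coe, LinearEquiv.trans_apply]
    erw [PiTensorProduct.reindex_tprod, PiTensorProduct.tmulEquiv_symm_apply]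
    simp only [TensorProduct.congr_tmul, PiTensorProduct.subsingletonEquiv_apply_tprod,
      LinearEquiv.refl_apply, TensorProduct.lift.tmul, LinearMap.comp_apply, LinearMap.lsmul_apply]
    congr 2
    funext i
    fin_cases i <;> rfl
  · rw [degComp_word_of_ne, degComp_word_of_ne, map_zero, smul_zero] <;> simpa using hw

theorem contrF_degComp (g : ℕ) (y : Vs g) (u : TT g) :
    contrF g y (degComp g 7 u) = ∑ q, omegaF g y (bas g q) • degComp g 6 (fstRem g q u) := by
  have h : contrF g y ∘ₗ degComp g 7
      = ∑ q, omegaF g y (bas g q) • (degComp g 6 ∘ₗ fstRem g q) := by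
    refine linearMap_ext_word g fun w => ?_
    cases w with
    | nil =>
      have h₁ : ∀ q, fstRem g q (word g []) = 0 := fun q => by
        simpa [word] using fstRem_algebraMap g q 1
      simp [degComp_word_of_ne g 7 [], h₁]
    | cons p w =>
      simp only [LinearMap.comp_apply, contrF_word, LinearMap.sum_apply, LinearMap.smul_apply]
      rw [Finset.sum_eq_single p] <;> simp +contextual [word_cons, fstRem_ltr_mul]
  simpa using DFunLike.congr_fun h u

theorem ESfull_eq (g : ℕ) (f : Vs g →ₗ[ℚ] TT g) :
    ESfull g f = (Wsub g).mkQ (degComp g 6 (dvg g f)) := by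
  have ha : ∀ i q, omegaF g (av g i) (bas g q) = if q = Sum.inr i then 1 else 0 := fun i q => by
    rcases q with j | j <;>
      simp [omegaF, coordF, av, bas, Pi.single_apply, eq_comm]
  have hb : ∀ i q, omegaF g (bv g i) (bas g q) = if q = Sum.inl i then -1 else 0 := fun i q => by
    rcases q with j | j <;>
      simp [omegaF, coordF, bv, bas, Pi.single_apply, eq_comm, apply_ite]
  simp only [ESfull, LinearMap.comp_apply, LinearMap.sum_apply, LinearMap.sub_apply,
    LinearMap.applyₗ_apply_apply, contrF_degComp, dvg, map_sum,
    Fintype.sum_sum_type (f := fun p => (Wsub g).mkQ _)]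
  rw [← Finset.sum_add_distrib]
  refine Finset.sum_congr rfl fun i _ => ?_
  simp [ha, hb, add_comm]
  rfl

theorem degComp_mem_Wsub (g : ℕ) {z : TT g} (hz : z ∈ commSub g) : degComp g 6 z ∈ Wsub g := by
  suffices h : commSub g ≤ (Wsub g).comap (degComp g 6) from h hz
  refine Submodule.span_le.2 ?_
  rintro _ ⟨p, u, rfl⟩
  have hu := mem_span_word g u
  change degComp g 6 (ltr g p * u - u * ltr g p) ∈ Wsub g
  induction hu using Submodule.span_induction with
  | mem x hx =>
    obtain ⟨w, rfl⟩ := hx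
    have h : word g w * ltr g p = word g (w ++ [p]) := by simp [word]
    rw [← word_cons, h, map_sub, ← degComp_word_rotate, ← neg_sub]
    exact neg_mem (Submodule.subset_span (Or.inl ⟨_, rfl⟩))
  | zero => simp
  | add x y _ _ hx hy =>
    convert add_mem hx hy using 1
    rw [← map_add]
    congr 1
    noncomm_ring
  | smul c x _ hx =>
    convert Submodule.smul_mem _ c hx using 1
    rw [← map_smul]
    simp [smul_sub]

theorem ESfull_eq_zero (g : ℕ) {f : Vs g →ₗ[ℚ] TT g} (hf : dvg g f ∈ commSub g) :
    ESfull g f = 0 := by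
  rw [ESfull_eq, Submodule.mkQ_apply, Submodule.Quotient.mk_eq_zero]
  exact degComp_mem_Wsub g hf

/-! ### Shuffles of coefficients of Lie elements -/

/-- The derivation `∂_p` with `∂_p x_q = δ_{pq}`, removing one occurrence of `p`. -/
def skip (g : ℕ) (p : Ltr g) : TT g →ₗ[ℚ] TT g :=
  derOf g (Algebra.linearMap ℚ (TT g) ∘ₗ coordF g p)

theorem skip_ι (g : ℕ) (p : Ltr g) (v : Vs g) :
    skip g p (TensorAlgebra.ι ℚ v) = algebraMap ℚ (TT g) (v p) := by
  simp [skip, derOf_ι, coordF]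

theorem skip_mul (g : ℕ) (p : Ltr g) (u v : TT g) :
    skip g p (u * v) = u * skip g p v + skip g p u * v := derOf_mul g _ u v

theorem skip_algebraMap (g : ℕ) (p : Ltr g) (c : ℚ) : skip g p (algebraMap ℚ (TT g) c) = 0 :=
  derOf_algebraMap g _ c

/-- The generator map of an algebra homomorphism to unitriangular-type matrices whose corner
entry removes a subsequence `p, q`. -/
def skipTwoGen (g : ℕ) (p q : Ltr g) : Vs g →ₗ[ℚ] Matrix (Fin 3) (Fin 3) (TT g) where
  toFun v := !![TensorAlgebra.ι ℚ v, algebraMap ℚ (TT g) (v p), 0;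
    0, TensorAlgebra.ι ℚ v, algebraMap ℚ (TT g) (v q); 0, 0, TensorAlgebra.ι ℚ v]
  map_add' v w := by ext i j; fin_cases i <;> fin_cases j <;> simp
  map_smul' c v := by ext i j; fin_cases i <;> fin_cases j <;> simp [← Algebra.smul_def]

/-- The operator removing one subsequence `p, q` from words. -/
def skipTwo (g : ℕ) (p q : Ltr g) : TT g →ₗ[ℚ] TT g where
  toFun u := TensorAlgebra.lift ℚ (skipTwoGen g p q) u 0 2
  map_add' u v := by simp
  map_smul' c u := by simp

theorem lift_skipTwoGen (g : ℕ) (p q : Ltr g) (u : TT g) :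
    TensorAlgebra.lift ℚ (skipTwoGen g p q) u
      = !![u, skip g p u, skipTwo g p q u; 0, u, skip g q u; 0, 0, u] := by
  suffices h : TensorAlgebra.lift ℚ (skipTwoGen g p q) u 0 0 = u
      ∧ TensorAlgebra.lift ℚ (skipTwoGen g p q) u 0 1 = skip g p u
      ∧ TensorAlgebra.lift ℚ (skipTwoGen g p q) u 1 0 = 0
      ∧ TensorAlgebra.lift ℚ (skipTwoGen g p q) u 1 1 = u
      ∧ TensorAlgebra.lift ℚ (skipTwoGen g p q) u 1 2 = skip g q u
      ∧ TensorAlgebra.lift ℚ (skipTwoGen g p q) u 2 0 = 0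
      ∧ TensorAlgebra.lift ℚ (skipTwoGen g p q) u 2 1 = 0
      ∧ TensorAlgebra.lift ℚ (skipTwoGen g p q) u 2 2 = u by
    ext i j; fin_cases i <;> fin_cases j <;> simp [h, skipTwo]
  induction u using TensorAlgebra.induction with
  | algebraMap c => simp [Matrix.algebraMap_matrix_apply, skip_algebraMap]
  | ι v => simp [skipTwoGen, skip_ι]
  | mul u v hu hv => simp [Matrix.mul_apply, Fin.sum_univ_three, hu, hv, skip_mul]
  | add u v hu hv => simp [hu, hv]

theorem skipTwo_mul (g : ℕ) (p q : Ltr g) (u v : TT g) :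
    skipTwo g p q (u * v)
      = u * skipTwo g p q v + skip g p u * skip g q v + skipTwo g p q u * v := by
  have h : skipTwo g p q (u * v) = TensorAlgebra.lift ℚ (skipTwoGen g p q) (u * v) 0 2 := rfl
  rw [h, map_mul, lift_skipTwoGen, lift_skipTwoGen]
  simp [Matrix.mul_apply, Fin.sum_univ_three]

theorem skipTwo_ι (g : ℕ) (p q : Ltr g) (v : Vs g) :
    skipTwo g p q (TensorAlgebra.ι ℚ v) = 0 := by
  simp [skipTwo, skipTwoGen]

theorem skipTwo_algebraMap (g : ℕ) (p q : Ltr g) (c : ℚ) :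
    skipTwo g p q (algebraMap ℚ (TT g) c) = 0 := by
  simp [skipTwo, Matrix.algebraMap_matrix_apply]

theorem skip_eq_sum (g : ℕ) (p : Ltr g) (u : TT g) :
    skip g p u = fstRem g p u + ∑ r, ltr g r * skip g p (fstRem g r u) := by
  conv_lhs => rw [eq_aug_add_sum g u]
  simp only [map_add, map_sum, skip_algebraMap, skip_mul, Finset.sum_add_distrib, zero_add]
  rw [add_comm]
  congr 1
  simp [ltr, skip_ι, bas_apply]

theorem skipTwo_eq_sum (g : ℕ) (p q : Ltr g) (u : TT g) :
    skipTwo g p q u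
      = skip g q (fstRem g p u) + ∑ r, ltr g r * skipTwo g p q (fstRem g r u) := by
  conv_lhs => rw [eq_aug_add_sum g u]
  simp only [map_add, map_sum, skipTwo_algebraMap, skipTwo_mul, Finset.sum_add_distrib, zero_add]
  rw [add_comm (∑ r, ltr g r * skipTwo g p q (fstRem g r u)), add_assoc]
  congr 1
  · simp [ltr, skip_ι, bas_apply]
  · simp [ltr, skipTwo_ι]

theorem fstRem_skip (g : ℕ) (r p : Ltr g) (u : TT g) :
    fstRem g r (skip g p u) = fstRem g r (fstRem g p u) + skip g p (fstRem g r u) := by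
  rw [skip_eq_sum g p u]
  simp [fstRem_ltr_mul, -Fintype.sum_sum_type]

theorem fstRem_skipTwo (g : ℕ) (r p q : Ltr g) (u : TT g) :
    fstRem g r (skipTwo g p q u)
      = fstRem g r (skip g q (fstRem g p u)) + skipTwo g p q (fstRem g r u) := by
  rw [skipTwo_eq_sum g p q u]
  simp [fstRem_ltr_mul, -Fintype.sum_sum_type]

theorem aug_skip (g : ℕ) (p : Ltr g) (u : TT g) : aug g (skip g p u) = aug g (fstRem g p u) := by
  rw [skip_eq_sum g p u]
  simp [aug_ltr]

theorem aug_skipTwo (g : ℕ) (p q : Ltr g) (u : TT g) :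
    aug g (skipTwo g p q u) = aug g (fstRem g q (fstRem g p u)) := by
  rw [skipTwo_eq_sum g p q u]
  simp [aug_ltr, aug_skip]

/-- All insertions of a letter into a word. -/
def insOne {α : Type*} (q : α) : List α → List (List α)
  | [] => [[q]]
  | r :: v => (q :: r :: v) :: (insOne q v).map (r :: ·)

/-- All shuffles of the two-letter word `p, q` with a word. -/
def shufTwo {α : Type*} (p q : α) : List α → List (List α)
  | [] => [[p, q]]
  | r :: v => (insOne q (r :: v)).map (p :: ·) ++ (shufTwo p q v).map (r :: ·)

theorem insOne_map {α β : Type*} (φ : α → β) (q : α) (v : List α) :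
    insOne (φ q) (v.map φ) = (insOne q v).map (List.map φ) := by
  induction v with
  | nil => rfl
  | cons r v ih => simp [insOne, ih]

theorem shufTwo_map {α β : Type*} (φ : α → β) (p q : α) (v : List α) :
    shufTwo (φ p) (φ q) (v.map φ) = (shufTwo p q v).map (List.map φ) := by
  induction v with
  | nil => rfl
  | cons r v ih =>
    have h := insOne_map φ q (r :: v)
    rw [List.map_cons] at h
    simp [shufTwo, ih, h, Function.comp_def]

theorem sum_insOne (g : ℕ) (q : Ltr g) (v : List (Ltr g)) (u : TT g) :
    ((insOne q v).map fun w => coef g w u).sum = coef g v (skip g q u) := by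
  induction v generalizing u with
  | nil => simp [insOne, coef_cons, coef_nil, aug_skip]
  | cons r v ih =>
    simp only [insOne, List.map_cons, List.sum_cons, List.map_map, Function.comp_def, coef_cons,
      fstRem_skip, map_add, ← ih]

theorem sum_shufTwo (g : ℕ) (p q : Ltr g) (v : List (Ltr g)) (u : TT g) :
    ((shufTwo p q v).map fun w => coef g w u).sum = coef g v (skipTwo g p q u) := by
  induction v generalizing u with
  | nil => simp [shufTwo, coef_cons, coef_nil, aug_skipTwo]
  | cons r v ih =>
    simp only [shufTwo, List.map_append, List.sum_append, List.map_map, Function.comp_def,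
      coef_cons, fstRem_skipTwo, map_add, ← ih, sum_insOne]

theorem skip_eq_zero (g n : ℕ) (p : Ltr g) {z : TT g} (hz : z ∈ LL g (n + 2)) :
    skip g p z = 0 := by
  suffices h : LL g (n + 2) ≤ LinearMap.ker (skip g p) from h hz
  clear hz z
  induction n with
  | zero =>
    refine LL_induction g 0 ?_
    rintro x _ ⟨y, rfl⟩
    simp only [LinearMap.mem_ker, map_sub, skip_mul, skip_ι, Algebra.commutes]
    abel
  | succ n ih =>
    refine LL_induction g (n + 1) fun x y hy => ?_
    have hy' : skip g p y = 0 := ih hy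
    simp [skip_mul, hy', skip_ι, Algebra.commutes]

theorem skipTwo_eq_zero (g n : ℕ) (p q : Ltr g) {z : TT g} (hz : z ∈ LL g (n + 3)) :
    skipTwo g p q z = 0 := by
  suffices h : LL g (n + 3) ≤ LinearMap.ker (skipTwo g p q) from h hz
  clear hz z
  induction n with
  | zero =>
    refine LL_induction g 1 fun x y hy => ?_
    have hp : skip g p y = 0 := skip_eq_zero g 0 p hy
    have hq : skip g q y = 0 := skip_eq_zero g 0 q hy
    have h : ∃ c : ℚ, skipTwo g p q y = algebraMap ℚ (TT g) c := by
      suffices h : LL g 2 ≤ (LinearMap.range (Algebra.linearMap ℚ (TT g))).comap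
          (skipTwo g p q) by
        obtain ⟨c, hc⟩ := h hy
        exact ⟨c, hc.symm⟩
      refine LL_induction g 0 ?_
      rintro x _ ⟨y, rfl⟩
      exact ⟨x p * y q - y p * x q, by simp [skipTwo_mul, skipTwo_ι, skip_ι]⟩
    obtain ⟨c, hc⟩ := h
    simp [skipTwo_mul, hp, hq, hc, skipTwo_ι, Algebra.commutes]
  | succ n ih =>
    refine LL_induction g (n + 2) fun x y hy => ?_
    have hp : skip g p y = 0 := skip_eq_zero g (n + 1) p hy
    have hq : skip g q y = 0 := skip_eq_zero g (n + 1) q hy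
    have hpq : skipTwo g p q y = 0 := ih hy
    simp [skipTwo_mul, hp, hq, hpq, skipTwo_ι]

/-- Lie elements are orthogonal to shuffles with a two-letter word. -/
theorem sum_shufTwo_eq_zero (g n : ℕ) (p q : Ltr g) (v : List (Ltr g)) {z : TT g}
    (hz : z ∈ LL g (n + 3)) : ((shufTwo p q v).map fun w => coef g w z).sum = 0 := by
  rw [sum_shufTwo, skipTwo_eq_zero g n p q hz, map_zero]

/-- Commutators are orthogonal to sums over cyclic rotations. -/
theorem sum_rotate_eq_zero (g : ℕ) (w : List (Ltr g)) {z : TT g} (hz : z ∈ commSub g) :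
    ((List.range w.length).map fun k => coef g (w.rotate k) z).sum = 0 := by
  suffices h : commSub g
      ≤ LinearMap.ker (∑ k ∈ Finset.range w.length, coef g (w.rotate k)) by
    have h' := h hz
    rw [LinearMap.mem_ker, LinearMap.sum_apply] at h'
    simpa [Finset.sum, Multiset.range] using h'
  refine Submodule.span_le.2 ?_
  rintro _ ⟨p, u, rfl⟩
  cases w with
  | nil => simp
  | cons a w =>
    have h : ∀ k, coef g ((a :: w).rotate k) (ltr g p * u)
        = coef g ((a :: w).rotate (k + 1)) (u * ltr g p) := fun k => by
      rw [← List.rotate_rotate]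
      have hne : (a :: w).rotate k ≠ [] := by simp
      obtain ⟨q, v, hv⟩ := List.exists_cons_of_ne_nil hne
      rw [hv, List.rotate_cons_succ, List.rotate_zero, coef_append_ltr, coef_cons, fstRem_ltr_mul]
      split_ifs <;> simp
    simp only [SetLike.mem_coe, LinearMap.mem_ker, LinearMap.sum_apply, map_sub, h]
    rw [← Finset.sum_sub_distrib,
      Finset.sum_range_sub (fun k => coef g ((a :: w).rotate k) (u * ltr g p)),
      List.rotate_length, List.rotate_zero, sub_self]

/-! ### Cyclic coefficients of symplectic derivations -/

/-- The sign of a letter: `1` for `aᵢ` and `-1` for `bᵢ`. -/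
def sgn (g : ℕ) (p : Ltr g) : ℚ := Sum.elim (fun _ => 1) (fun _ => -1) p

theorem sgn_swap (g : ℕ) (p : Ltr g) : sgn g p.swap = -sgn g p := by
  cases p <;> simp [sgn]

theorem sgn_mul_self (g : ℕ) (p : Ltr g) : sgn g p * sgn g p = 1 := by
  cases p <;> simp [sgn]

/-- The coefficients of the tensor in `H ⊗ T` corresponding to `f : H → T` under the duality
given by the symplectic form. -/
def hat (g : ℕ) : List (Ltr g) → ((Vs g →ₗ[ℚ] TT g) →ₗ[ℚ] ℚ)
  | [] => 0
  | p :: w => sgn g p.swap • coef g w ∘ₗ LinearMap.applyₗ (bas g p.swap)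

theorem hat_cons (g : ℕ) (p : Ltr g) (w : List (Ltr g)) (f : Vs g →ₗ[ℚ] TT g) :
    hat g (p :: w) f = sgn g p.swap * coef g w (f (bas g p.swap)) := rfl

theorem coef_apply_bas (g : ℕ) (p : Ltr g) (w : List (Ltr g)) (f : Vs g →ₗ[ℚ] TT g) :
    coef g w (f (bas g p)) = sgn g p * hat g (p.swap :: w) f := by
  rw [hat_cons, Sum.swap_swap, ← mul_assoc, sgn_mul_self, one_mul]

theorem sum_swap (g : ℕ) {M : Type*} [AddCommMonoid M] (F : Ltr g → M) :
    ∑ p : Ltr g, F p.swap = ∑ p, F p :=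
  Fintype.sum_equiv (Equiv.sumComm _ _) _ _ fun _ => rfl

theorem sympCond_eq_sum (g : ℕ) (f : Vs g →ₗ[ℚ] TT g) :
    sympCond g f
      = ∑ p, sgn g p • (f (bas g p) * ltr g p.swap - ltr g p.swap * f (bas g p)) := by
  rw [Fintype.sum_sum_type, ← Finset.sum_add_distrib]
  rw [sympCond, LinearMap.sum_apply]
  refine Finset.sum_congr rfl fun i _ => ?_
  simp only [brkt, sgn, bas, ltr, av, bv, LinearMap.sub_apply, LinearMap.comp_apply,
    LinearMap.applyₗ_apply_apply, LinearMap.mulRight_apply, LinearMap.mulLeft_apply, Sum.elim_inl,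
    Sum.elim_inr, Sum.swap_inl, Sum.swap_inr, one_smul, neg_smul]
  abel

theorem coef_sympCond (g : ℕ) (p : Ltr g) (w : List (Ltr g)) (q : Ltr g) (f : Vs g →ₗ[ℚ] TT g)
    {u : List (Ltr g)} (hu : q :: u = w ++ [p]) :
    coef g (w ++ [p]) (sympCond g f) = hat g (p :: w) f - hat g (w ++ [p]) f := by
  rw [sympCond_eq_sum, ← sum_swap]
  simp only [map_sum, map_smul, map_sub, coef_append_ltr, Sum.swap_swap]
  conv_lhs => rw [← hu]
  rw [← hu]
  simp only [coef_cons, fstRem_ltr_mul, hat_cons, smul_eq_mul, mul_sub, Finset.sum_sub_distrib]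
  simp [apply_ite (coef g u), -Fintype.sum_sum_type]

/-- Cyclic invariance of the coefficients of a symplectic derivation. -/
theorem hat_rotate (g : ℕ) {f : Vs g →ₗ[ℚ] TT g} (hf : sympCond g f = 0) (p : Ltr g)
    (w : List (Ltr g)) : hat g (w ++ [p]) f = hat g (p :: w) f := by
  cases w with
  | nil => rfl
  | cons q w =>
    have h := coef_sympCond g p (q :: w) q f (u := w ++ [p]) rfl
    rw [hf, map_zero] at h
    linarith

theorem coef_dvg (g : ℕ) (w : List (Ltr g)) (f : Vs g →ₗ[ℚ] TT g) :
    coef g w (dvg g f) = -∑ p, sgn g p * hat g (p :: p.swap :: w) f := by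
  rw [← sum_swap]
  simp only [dvg, map_sum, ← coef_cons, coef_apply_bas, sgn_swap, Sum.swap_swap, neg_mul,
    Finset.sum_neg_distrib, neg_neg]

theorem coef_pair_antisymm (g : ℕ) {z : TT g} (hz : z ∈ LL g 2) (p q : Ltr g) :
    coef g [p, q] z = -coef g [q, p] z := by
  suffices h : LL g 2 ≤ LinearMap.ker (coef g [p, q] + coef g [q, p]) from
    eq_neg_of_add_eq_zero_left (h hz)
  refine LL_induction g 0 ?_
  rintro x _ ⟨y, rfl⟩
  simp [coef_cons, coef_nil, fstRem_mul, fstRem_ι, fstRem_algebraMap, ← Algebra.smul_def]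
  ring

theorem fstRem_eq_sum (g : ℕ) {z : TT g} (hz : z ∈ LL g 2) (p : Ltr g) :
    fstRem g p z = ∑ r, coef g [p, r] z • ltr g r := by
  suffices h : LL g 2 ≤ LinearMap.ker
      (fstRem g p - ∑ r, (coef g [p, r]).smulRight (ltr g r)) by
    have h' := h hz
    simpa [sub_eq_zero, LinearMap.sum_apply, -Fintype.sum_sum_type] using h'
  refine LL_induction g 0 ?_
  rintro x _ ⟨y, rfl⟩
  simp [coef_cons, coef_nil, fstRem_mul, fstRem_ι, ← Algebra.smul_def, aug_ι,
    LinearMap.sum_apply, sub_smul, Finset.sum_sub_distrib, -Fintype.sum_sum_type]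
  simp [mul_smul, ← Finset.smul_sum, ι_eq_sum, -Fintype.sum_sum_type]

theorem hat_swap_last (g : ℕ) {t : Vs g →ₗ[ℚ] TT g} (ht : t ∈ hh g 1) (i j k : Ltr g) :
    hat g [i, k, j] t = -hat g [i, j, k] t := by
  rw [hat_cons, hat_cons, coef_pair_antisymm g (ht.1 _) k j, mul_neg]

theorem hat_rotate_three (g : ℕ) {t : Vs g →ₗ[ℚ] TT g} (ht : t ∈ hh g 1) (i j k : Ltr g) :
    hat g [j, k, i] t = hat g [i, j, k] t := hat_rotate g ht.2 i [j, k]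

theorem hat_swap_first (g : ℕ) {t : Vs g →ₗ[ℚ] TT g} (ht : t ∈ hh g 1) (i j k : Ltr g) :
    hat g [j, i, k] t = -hat g [i, j, k] t := by
  rw [← hat_rotate_three g ht i j k, hat_swap_last g ht]

theorem aug_derOf (g : ℕ) {t : Vs g →ₗ[ℚ] TT g} (ht : t ∈ hh g 1) (u : TT g) :
    aug g (derOf g t u) = 0 := by
  induction u using TensorAlgebra.induction with
  | algebraMap c => simp [derOf_algebraMap]
  | ι v => rw [derOf_ι]; exact aug_of_mem_LL g _ (ht.1 v)
  | mul u v hu hv => simp [derOf_mul, hu, hv]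
  | add u v hu hv => simp [hu, hv]

theorem coef_singleton_derOf (g : ℕ) {t : Vs g →ₗ[ℚ] TT g} (ht : t ∈ hh g 1) (i : Ltr g)
    (u : TT g) : coef g [i] (derOf g t u) = 0 := by
  rw [coef_cons, fstRem_derOf g fun v => aug_of_mem_LL g _ (ht.1 v), map_add, coef_nil, coef_nil,
    aug_derOf g ht]
  simp [fstRem_eq_sum g (ht.1 _) i, aug_ltr, -Fintype.sum_sum_type]

theorem coef_cons_cons_derOf (g : ℕ) {t : Vs g →ₗ[ℚ] TT g} (ht : t ∈ hh g 1) (i k : Ltr g)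
    (w : List (Ltr g)) (u : TT g) :
    coef g (i :: k :: w) (derOf g t u)
      = ∑ j, sgn g j * hat g [j.swap, i, k] t * coef g (j :: w) u
        + coef g (k :: w) (derOf g t (fstRem g i u)) := by
  rw [coef_cons, fstRem_derOf g fun v => aug_of_mem_LL g _ (ht.1 v), map_add, map_sum]
  congr 1
  refine Finset.sum_congr rfl fun j _ => ?_
  rw [fstRem_eq_sum g (ht.1 _) i, Finset.sum_mul, map_sum]
  simp only [coef_cons g k, coef_cons g j, smul_mul_assoc, map_smul, fstRem_ltr_mul]
  rw [Finset.sum_eq_single k (fun r _ hr => by simp [hr.symm]) (by simp)]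
  simp [coef_apply_bas]

theorem coef_derOf_apply (g : ℕ) {f : Vs g →ₗ[ℚ] TT g} (hf : ∀ v, aug g (f v) = 0)
    {z : TT g} (hz : z ∈ LL g 2) (p q : Ltr g) (w : List (Ltr g)) :
    coef g (p :: (w ++ [q])) (derOf g f z)
      = ∑ k, coef g [k, q] z * coef g (p :: w) (f (bas g k))
        + ∑ k, coef g [p, k] z * coef g (w ++ [q]) (f (bas g k)) := by
  rw [coef_cons, fstRem_derOf g hf, map_add, map_sum]
  congr 1
  · refine Finset.sum_congr rfl fun k _ => ?_
    rw [fstRem_eq_sum g hz k, Finset.mul_sum, map_sum]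
    simp only [mul_smul_comm, map_smul, coef_append_ltr, smul_eq_mul]
    simp [coef_cons, -Fintype.sum_sum_type]
  · rw [fstRem_eq_sum g hz p]
    simp [ltr, derOf_ι, -Fintype.sum_sum_type]

/-- The coefficients of a bracket with an element of degree one. -/
theorem hat_brkH (g : ℕ) {f : Vs g →ₗ[ℚ] TT g} (hf : ∀ v, aug g (f v) = 0)
    {t : Vs g →ₗ[ℚ] TT g} (ht : t ∈ hh g 1) (a₀ a₁ a₂ a₃ a₄ a₅ a₆ a₇ : Ltr g) :
    hat g [a₀, a₁, a₂, a₃, a₄, a₅, a₆, a₇] (brkH g f t)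
      = -∑ j, sgn g j * (hat g [j.swap, a₀, a₁] t * hat g [j, a₂, a₃, a₄, a₅, a₆, a₇] f
        + hat g [j.swap, a₁, a₂] t * hat g [a₀, j, a₃, a₄, a₅, a₆, a₇] f
        + hat g [j.swap, a₂, a₃] t * hat g [a₀, a₁, j, a₄, a₅, a₆, a₇] f
        + hat g [j.swap, a₃, a₄] t * hat g [a₀, a₁, a₂, j, a₅, a₆, a₇] f
        + hat g [j.swap, a₄, a₅] t * hat g [a₀, a₁, a₂, a₃, j, a₆, a₇] f
        + hat g [j.swap, a₅, a₆] t * hat g [a₀, a₁, a₂, a₃, a₄, j, a₇] f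
        + hat g [j.swap, a₆, a₇] t * hat g [a₀, a₁, a₂, a₃, a₄, a₅, j] f
        + hat g [j.swap, a₇, a₀] t * hat g [j, a₁, a₂, a₃, a₄, a₅, a₆] f) := by
  have h₀ : coef g [a₁, a₂, a₃, a₄, a₅, a₆, a₇] (derOf g f (t (bas g a₀.swap))) = _ :=
    coef_derOf_apply g hf (ht.1 _) a₁ a₇ [a₂, a₃, a₄, a₅, a₆]
  rw [hat_cons, brkH, LinearMap.sub_apply, map_sub, LinearMap.comp_apply, LinearMap.comp_apply, h₀]
  simp only [List.cons_append, List.nil_append, coef_cons_cons_derOf g ht,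
    coef_singleton_derOf g ht, ← coef_cons, coef_apply_bas, Sum.swap_swap, add_zero]
  rw [← sum_swap g fun x => sgn g a₀.swap * hat g [a₀, x, a₇] t * (sgn g x * _),
    ← sum_swap g fun x => sgn g a₀.swap * hat g [a₀, a₁, x] t * (sgn g x * _)]
  simp only [← Finset.sum_add_distrib, ← Finset.sum_sub_distrib, Finset.mul_sum,
    ← Finset.sum_neg_distrib, Sum.swap_swap, sgn_swap g a₀]
  refine Finset.sum_congr rfl fun j _ => ?_
  have h₁ := hat_rotate_three g ht a₀ j.swap a₇
  have h₂ := hat_rotate_three g ht j.swap a₀ a₁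
  rw [sgn_swap, ← h₁, h₂]
  obtain h | h := mul_self_eq_one_iff.1 (sgn_mul_self g a₀) <;> rw [h] <;> ring

/-! ### Normal forms for signed symmetries -/

/-- The lexicographic order on words. -/
def lexLt {n : ℕ} : List (Fin n) → List (Fin n) → Bool
  | [], [] => false
  | [], _ :: _ => true
  | _ :: _, [] => false
  | a :: u, b :: v => a.1.blt b.1 || (a.1.beq b.1 && lexLt u v)

/-- An operation on words together with a sign. -/
abbrev Move (n : ℕ) : Type := List (Fin n) → ℤ × List (Fin n)

/-- The composition of two signed operations. -/
def compMove {n : ℕ} (a b : Move n) : Move n := fun w => ((a w).1 * (b (a w).2).1, (b (a w).2).2)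

/-- Apply a relabelling with sign `s` if the letter `q` occurs before the letter `p`. -/
def orient {n : ℕ} (s : ℤ) (σ : Fin n → Fin n) (p q : Fin n) : Move n := fun w =>
  if (w.idxOf q).blt (w.idxOf p) then (s, w.map σ) else (1, w)

/-- Formal integer combinations of words. -/
abbrev Terms (n : ℕ) : Type := List (ℤ × List (Fin n))

/-- One step in the search for the smallest word in an orbit. -/
def canonStep {n : ℕ} (c : ℤ) (u : List (Fin n)) (acc : ℤ × List (Fin n)) : ℤ × List (Fin n) :=
  if lexLt u acc.2 then (c, u)
  else if u = acc.2 then (if c = acc.1 then acc else (0, u)) else acc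

/-- The smallest word in the orbit of a word, with its sign. -/
def canon {n : ℕ} (A : List (Move n)) (w : List (Fin n)) : ℤ × List (Fin n) :=
  A.foldl (fun acc a => canonStep (a w).1 (a w).2 acc) (1, w)

/-- Add a multiple of a word to a formal combination. -/
def insTerm {n : ℕ} (c : ℤ) (u : List (Fin n)) : Terms n → Terms n
  | [] => [(c, u)]
  | x :: L => if x.2 = u then (c + x.1, u) :: L else x :: insTerm c u L

/-- The normal form of a formal combination modulo signed symmetries. -/
def normTerms {n : ℕ} (A : List (Move n)) : Terms n → Terms n
  | [] => []
  | x :: L => insTerm (x.1 * (canon A x.2).1) (canon A x.2).2 (normTerms A L)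

section Normalization

variable {n : ℕ} {M : Type*} [AddCommGroup M] (E : List (Fin n) → M)

/-- The operation is a signed symmetry of `E`. -/
def IsSymm (a : Move n) : Prop := ∀ w, E w = (a w).1 • E (a w).2

theorem IsSymm.comp {a b : Move n} (ha : IsSymm E a) (hb : IsSymm E b) :
    IsSymm E (compMove a b) := by
  intro w
  rw [ha w, hb (a w).2, smul_smul]
  rfl

theorem IsSymm.orient {s : ℤ} {σ : Fin n → Fin n} (h : ∀ w, E w = s • E (w.map σ))
    (p q : Fin n) : IsSymm E (orient s σ p q) := by
  intro w
  unfold _root_.orient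
  split_ifs
  · exact h w
  · exact (one_smul ℤ _).symm

/-- The value of `E` on a formal combination. -/
def evalTerms (L : Terms n) : M := (L.map fun x => x.1 • E x.2).sum

theorem evalTerms_cons (x : ℤ × List (Fin n)) (L : Terms n) :
    evalTerms E (x :: L) = x.1 • E x.2 + evalTerms E L := by
  simp [evalTerms]

theorem evalTerms_append (L L' : Terms n) :
    evalTerms E (L ++ L') = evalTerms E L + evalTerms E L' := by
  simp [evalTerms]

theorem evalTerms_scale (c : ℤ) (L : Terms n) :
    evalTerms E (L.map fun x => (c * x.1, x.2)) = c • evalTerms E L := by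
  simp [evalTerms, List.smul_sum, Function.comp_def, mul_smul]

theorem evalTerms_insTerm (c : ℤ) (u : List (Fin n)) (L : Terms n) :
    evalTerms E (insTerm c u L) = c • E u + evalTerms E L := by
  induction L with
  | nil => simp [insTerm, evalTerms]
  | cons x L ih =>
    unfold insTerm
    split_ifs with h
    · simp only [evalTerms_cons, h, add_smul, add_assoc]
    · rw [evalTerms_cons, ih, evalTerms_cons, add_left_comm]

variable [Module ℚ M]

theorem canonStep_spec {w u : List (Fin n)} {c : ℤ} {acc : ℤ × List (Fin n)}
    (hu : E w = c • E u) (hacc : E w = acc.1 • E acc.2) :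
    E w = (canonStep c u acc).1 • E (canonStep c u acc).2 := by
  unfold canonStep
  split_ifs with h₁ h₂ h₃
  · exact hu
  · exact hacc
  · have h : (c - acc.1) • E u = 0 := by rw [sub_smul, ← hu, h₂, ← hacc, sub_self]
    have h' : ((c - acc.1 : ℤ) : ℚ) • E u = 0 := by rw [Int.cast_smul_eq_zsmul, h]
    obtain h₄ | h₄ := smul_eq_zero.1 h'
    · exact absurd (sub_eq_zero.1 (Int.cast_eq_zero.1 h₄)) h₃
    · rw [hu, h₄, smul_zero, smul_zero]
  · exact hacc

theorem canon_spec {A : List (Move n)} (hA : ∀ a ∈ A, IsSymm E a) (w : List (Fin n)) :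
    E w = (canon A w).1 • E (canon A w).2 := by
  suffices h : ∀ acc : ℤ × List (Fin n), E w = acc.1 • E acc.2 → ∀ B : List (Move n),
      (∀ a ∈ B, IsSymm E a) →
      E w = (B.foldl (fun acc a => canonStep (a w).1 (a w).2 acc) acc).1
        • E (B.foldl (fun acc a => canonStep (a w).1 (a w).2 acc) acc).2 from
    h (1, w) (by simp) A hA
  intro acc hacc B hB
  induction B generalizing acc with
  | nil => exact hacc
  | cons a B ih =>
    exact ih _ (canonStep_spec E (hB a (by simp) w) hacc)
      fun b hb => hB b (List.mem_cons_of_mem _ hb)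

theorem evalTerms_normTerms {A : List (Move n)} (hA : ∀ a ∈ A, IsSymm E a) (L : Terms n) :
    evalTerms E (normTerms A L) = evalTerms E L := by
  induction L with
  | nil => rfl
  | cons x L ih =>
    rw [normTerms, evalTerms_insTerm, ih, evalTerms_cons, mul_smul, ← canon_spec E hA]

theorem evalTerms_eq_zero {A : List (Move n)} (hA : ∀ a ∈ A, IsSymm E a) (L : Terms n)
    (h : ((normTerms A L).all fun x => x.1 == 0) = true) : evalTerms E L = 0 := by
  rw [← evalTerms_normTerms E hA, evalTerms]
  refine List.sum_eq_zero fun m hm => ?_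
  obtain ⟨x, hx, rfl⟩ := List.mem_map.1 hm
  have h' : x.1 = 0 := by simpa using List.all_eq_true.1 h x hx
  rw [h', zero_smul]

end Normalization

/-! ### An invariant of degree six vanishing on brackets -/

/-- The relabelling of tokens in the order of their appearance. -/
def normalizeTokens : Move 7 :=
  compMove (orient (-1) (Equiv.swap 0 1) 0 1)
    (compMove (orient (-1) (Equiv.swap 2 3) 2 3)
      (compMove (orient 1 (Equiv.swap 0 2 ∘ Equiv.swap 1 3) 0 2)
        (compMove (orient (-1) (Equiv.swap 4 5) 4 5)
          (compMove (orient (-1) (Equiv.swap 5 6) 5 6) (orient (-1) (Equiv.swap 4 5) 4 5)))))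

/-- The symmetries of the pairing sums: rotation and relabelling. -/
def pairMoves : List (Move 7) :=
  (List.range 7).map fun k => compMove (fun w => (1, w.rotate k)) normalizeTokens

/-- The expansion of the invariant on a bracket. -/
def brkTerms : Terms 7 :=
  [(1, [4, 0, 2, 1, 5, 3, 6]), (1, [0, 4, 2, 6, 1, 3, 5]), (1, [0, 2, 4, 5, 1, 6, 3]),
    (-1, [0, 2, 6, 4, 1, 5, 3]), (1, [6, 0, 5, 2, 4, 3, 1]), (1, [5, 0, 2, 6, 3, 4, 1]),
    (1, [0, 6, 2, 5, 3, 1, 4]), (-1, [4, 5, 0, 2, 1, 6, 3])]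

/-- Shuffle relations. -/
def shufTerms (c p q : Fin 7) (v : List (Fin 7)) : Terms 7 :=
  (shufTwo p q v).map fun w => (1, c :: w)

/-- Rotation relations. -/
def rotTerms (u v : List (Fin 7)) : Terms 7 :=
  (List.range v.length).map fun k => (1, u ++ v.rotate k)

/-- A combination of the expansion on a bracket with relations. -/
def certTerms : Terms 7 :=
  brkTerms.map (fun x => (2 * x.1, x.2))
    ++ ((shufTerms 0 2 4 [3, 5, 1, 6]).map (fun x => (-2 * x.1, x.2))
    ++ ((shufTerms 0 2 3 [4, 1, 6, 5]).map (fun x => (3 * x.1, x.2))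
    ++ ((rotTerms [0] [1, 2, 4, 5, 6, 3]).map (fun x => (-3 * x.1, x.2))
    ++ (rotTerms [0, 1] [2, 4, 3, 5, 6]).map (fun x => (3 * x.1, x.2)))))

theorem normTerms_certTerms :
    ((normTerms pairMoves certTerms).all fun x => x.1 == 0) = true := by
  decide +kernel

/-- The letters assigned to the tokens: two dual pairs and three free letters. -/
def val (g : ℕ) (x : Ltr g × Ltr g × Ltr g × Ltr g × Ltr g) : Fin 7 → Ltr g :=
  ![x.1, x.1.swap, x.2.1, x.2.1.swap, x.2.2.1, x.2.2.2.1, x.2.2.2.2]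

/-- The weight of an assignment of letters to tokens. -/
def wt (g : ℕ) (t : Vs g →ₗ[ℚ] TT g) (x : Ltr g × Ltr g × Ltr g × Ltr g × Ltr g) : ℚ :=
  sgn g x.1 * (sgn g x.2.1 * (sgn g x.2.2.1 * sgn g x.2.2.2.1 * sgn g x.2.2.2.2
    * hat g [x.2.2.1.swap, x.2.2.2.1.swap, x.2.2.2.2.swap] t))

/-- The pairing of `f` and `t` encoded by a word of tokens. -/
def pairSum (g : ℕ) (f t : Vs g →ₗ[ℚ] TT g) (w : List (Fin 7)) : ℚ :=
  ∑ x, wt g t x * hat g (w.map (val g x)) f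

theorem pairSum_map (g : ℕ) (f t : Vs g →ₗ[ℚ] TT g) {s : ℤ} {σ : Fin 7 → Fin 7}
    (e : Ltr g × Ltr g × Ltr g × Ltr g × Ltr g → Ltr g × Ltr g × Ltr g × Ltr g × Ltr g)
    (he : Function.Involutive e) (hv : ∀ x n, val g (e x) n = val g x (σ n))
    (hw : ∀ x, wt g t (e x) = s * wt g t x) (w : List (Fin 7)) :
    pairSum g f t w = s • pairSum g f t (w.map σ) := by
  rw [pairSum, ← he.bijective.sum_comp, pairSum, zsmul_eq_mul, Finset.mul_sum]
  refine Finset.sum_congr rfl fun x _ => ?_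
  rw [hw, mul_assoc, List.map_map, List.map_congr_left fun n _ => hv x n]
  rfl

theorem isSymm_normalizeTokens (g : ℕ) (f : Vs g →ₗ[ℚ] TT g) {t : Vs g →ₗ[ℚ] TT g}
    (ht : t ∈ hh g 1) : IsSymm (pairSum g f t) normalizeTokens := by
  have h₁ := pairSum_map g f t (s := -1) (σ := Equiv.swap 0 1)
    (fun x => (x.1.swap, x.2)) (fun x => by simp)
    (fun x n => by fin_cases n <;> simp [val, Equiv.swap_apply_def])
    (fun x => by simp [wt, sgn_swap])
  have h₂ := pairSum_map g f t (s := -1) (σ := Equiv.swap 2 3)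
    (fun x => (x.1, x.2.1.swap, x.2.2)) (fun x => by simp)
    (fun x n => by fin_cases n <;> simp [val, Equiv.swap_apply_def])
    (fun x => by simp [wt, sgn_swap])
  have h₃ := pairSum_map g f t (s := 1) (σ := Equiv.swap 0 2 ∘ Equiv.swap 1 3)
    (fun x => (x.2.1, x.1, x.2.2)) (fun x => rfl)
    (fun x n => by fin_cases n <;> simp [val, Equiv.swap_apply_def])
    (fun x => by simp [wt, mul_left_comm])
  have h₄ := pairSum_map g f t (s := -1) (σ := Equiv.swap 4 5)
    (fun x => (x.1, x.2.1, x.2.2.2.1, x.2.2.1, x.2.2.2.2)) (fun x => rfl)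
    (fun x n => by fin_cases n <;> simp [val, Equiv.swap_apply_def])
    (fun x => by simp only [wt, hat_swap_first g ht x.2.2.1.swap]; push_cast; ring)
  have h₅ := pairSum_map g f t (s := -1) (σ := Equiv.swap 5 6)
    (fun x => (x.1, x.2.1, x.2.2.1, x.2.2.2.2, x.2.2.2.1)) (fun x => rfl)
    (fun x n => by fin_cases n <;> simp [val, Equiv.swap_apply_def])
    (fun x => by simp only [wt, hat_swap_last g ht _ x.2.2.2.1.swap]; push_cast; ring)
  exact (IsSymm.orient _ h₁ 0 1).comp _ <| (IsSymm.orient _ h₂ 2 3).comp _ <|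
    (IsSymm.orient _ h₃ 0 2).comp _ <| (IsSymm.orient _ h₄ 4 5).comp _ <|
    (IsSymm.orient _ h₅ 5 6).comp _ <| IsSymm.orient _ h₄ 4 5

theorem hat_list_rotate (g : ℕ) {f : Vs g →ₗ[ℚ] TT g} (hf : sympCond g f = 0)
    (w : List (Ltr g)) (k : ℕ) : hat g (w.rotate k) f = hat g w f := by
  induction k generalizing w with
  | zero => simp
  | succ k ih =>
    cases w with
    | nil => simp
    | cons p w => rw [List.rotate_cons_succ, ih, hat_rotate g hf]

theorem isSymm_pairMoves (g : ℕ) {f t : Vs g →ₗ[ℚ] TT g} (hf : sympCond g f = 0)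
    (ht : t ∈ hh g 1) : ∀ a ∈ pairMoves, IsSymm (pairSum g f t) a := by
  intro a ha
  obtain ⟨k, -, rfl⟩ := List.mem_map.1 ha
  refine IsSymm.comp _ (fun w => ?_) (isSymm_normalizeTokens g f ht)
  simp only [pairSum, List.map_rotate, hat_list_rotate g hf, one_smul]

theorem list_sum_finset_sum {ι κ : Type*} [Fintype κ] (L : List ι) (F : κ → ι → ℚ) :
    (L.map fun w => ∑ x, F x w).sum = ∑ x, (L.map (F x)).sum := by
  induction L with
  | nil => simp
  | cons w L ih => simp [ih, Finset.sum_add_distrib]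

theorem evalTerms_shufTerms (g n : ℕ) (t : Vs g →ₗ[ℚ] TT g) {f : Vs g →ₗ[ℚ] TT g}
    (hf : ∀ v, f v ∈ LL g (n + 3)) (c p q : Fin 7) (v : List (Fin 7)) :
    evalTerms (pairSum g f t) (shufTerms c p q v) = 0 := by
  simp only [evalTerms, shufTerms, List.map_map, Function.comp_def, one_smul, pairSum,
    list_sum_finset_sum, List.map_cons, hat_cons, List.sum_map_mul_left]
  refine Finset.sum_eq_zero fun x _ => ?_
  have h := sum_shufTwo_eq_zero g n (val g x p) (val g x q) (v.map (val g x))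
    (hf (bas g (val g x c).swap))
  rw [shufTwo_map, List.map_map] at h
  simp only [Function.comp_def] at h
  rw [h, mul_zero, mul_zero]

theorem evalTerms_rotTerms (g : ℕ) (t : Vs g →ₗ[ℚ] TT g) {f : Vs g →ₗ[ℚ] TT g}
    (hf : ∀ v, f v ∈ commSub g) (c : Fin 7) (v : List (Fin 7)) :
    evalTerms (pairSum g f t) (rotTerms [c] v) = 0 := by
  simp only [evalTerms, rotTerms, List.map_map, Function.comp_def, one_smul, pairSum,
    list_sum_finset_sum, List.cons_append, List.nil_append, List.map_cons, hat_cons,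
    List.sum_map_mul_left, List.map_rotate]
  refine Finset.sum_eq_zero fun x _ => ?_
  have h := sum_rotate_eq_zero g (v.map (val g x)) (hf (bas g (val g x c).swap))
  rw [List.length_map] at h
  rw [h, mul_zero, mul_zero]

theorem evalTerms_rotTerms_of_dvg (g : ℕ) (t : Vs g →ₗ[ℚ] TT g) {f : Vs g →ₗ[ℚ] TT g}
    (hf : dvg g f ∈ commSub g) :
    evalTerms (pairSum g f t) (rotTerms [0, 1] [2, 4, 3, 5, 6]) = 0 := by
  have h : ∀ k, pairSum g f t ([0, 1] ++ [2, 4, 3, 5, 6].rotate k)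
      = ∑ y : Ltr g × Ltr g × Ltr g × Ltr g, -(sgn g y.1 * (sgn g y.2.1 * sgn g y.2.2.1
        * sgn g y.2.2.2 * hat g [y.2.1.swap, y.2.2.1.swap, y.2.2.2.swap] t)
        * coef g ([y.1, y.2.1, y.1.swap, y.2.2.1, y.2.2.2].rotate k) (dvg g f)) := fun k => by
    rw [pairSum, Fintype.sum_prod_type_right]
    refine Finset.sum_congr rfl fun y _ => ?_
    rw [coef_dvg, mul_neg, neg_neg, Finset.mul_sum]
    refine Finset.sum_congr rfl fun p _ => ?_
    simp only [wt, List.map_append, List.map_rotate]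
    simp [val]
    ring
  simp only [evalTerms, rotTerms, List.map_map, Function.comp_def, one_smul, h,
    list_sum_finset_sum]
  refine Finset.sum_eq_zero fun y _ => ?_
  have h' := sum_rotate_eq_zero g [y.1, y.2.1, y.1.swap, y.2.2.1, y.2.2.2] hf
  simp only [← neg_mul, List.sum_map_mul_left]
  simp only [List.length_cons, List.length_nil] at h' ⊢
  rw [h', mul_zero]

theorem evalTerms_brkTerms (g : ℕ) {f t : Vs g →ₗ[ℚ] TT g} (hf : f ∈ hh g 5)
    (hd : dvg g f ∈ commSub g) (ht : t ∈ hh g 1) : evalTerms (pairSum g f t) brkTerms = 0 := by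
  have h := evalTerms_eq_zero _ (isSymm_pairMoves g hf.2 ht) certTerms normTerms_certTerms
  simp only [certTerms, evalTerms_append, evalTerms_scale, evalTerms_shufTerms g 3 t hf.1,
    evalTerms_rotTerms g t fun v => LL_le_comm g 4 (hf.1 v), evalTerms_rotTerms_of_dvg g t hd,
    smul_zero, add_zero] at h
  simpa using h

/-- A linear form on derivations of degree six contracting the cyclic coefficients along a fixed
chord diagram with four chords. -/
def chordForm (g : ℕ) : (Vs g →ₗ[ℚ] TT g) →ₗ[ℚ] ℚ :=
  ∑ p, ∑ q, ∑ r, ∑ s, (sgn g p * sgn g q * sgn g r * sgn g s)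
    • hat g [p, q, r, s, r.swap, p.swap, s.swap, q.swap]

/-- The product of the signs of five letters. -/
def chordWt (g : ℕ) (x : Ltr g × Ltr g × Ltr g × Ltr g × Ltr g) : ℚ :=
  sgn g x.1 * sgn g x.2.1 * sgn g x.2.2.1 * sgn g x.2.2.2.1 * sgn g x.2.2.2.2

theorem sum_eq_pairSum (g : ℕ) (f t : Vs g →ₗ[ℚ] TT g) (s : ℚ) (w : List (Fin 7))
    {F : Ltr g × Ltr g × Ltr g × Ltr g × Ltr g → ℚ}
    (e e' : Ltr g × Ltr g × Ltr g × Ltr g × Ltr g → Ltr g × Ltr g × Ltr g × Ltr g × Ltr g)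
    (h₁ : Function.LeftInverse e' e) (h₂ : Function.LeftInverse e e')
    (h : ∀ x, F x = s * (wt g t (e x) * hat g (w.map (val g (e x))) f)) :
    ∑ x, F x = s * pairSum g f t w := by
  rw [pairSum, Finset.mul_sum]
  exact Fintype.sum_equiv ⟨e, e', h₁, h₂⟩ _ _ h

theorem chordForm_brkH (g : ℕ) {f t : Vs g →ₗ[ℚ] TT g} (hf : f ∈ hh g 5) (ht : t ∈ hh g 1) :
    chordForm g (brkH g f t) = -evalTerms (pairSum g f t) brkTerms := by
  have h₀ : ∑ x, chordWt g x * (hat g [x.2.2.2.2.swap, x.1, x.2.1] t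
      * hat g [x.2.2.2.2, x.2.2.1, x.2.2.2.1, x.2.2.1.swap, x.1.swap, x.2.2.2.1.swap, x.2.1.swap] f)
        = 1 * pairSum g f t [4, 0, 2, 1, 5, 3, 6] :=
    sum_eq_pairSum g f t 1 _ (fun x => (x.2.2.1, x.2.2.2.1, x.2.2.2.2, x.1.swap, x.2.1.swap))
      (fun x => (x.2.2.2.1.swap, x.2.2.2.2.swap, x.1, x.2.1, x.2.2.1))
      (fun x => by simp) (fun x => by simp) fun x => by simp [chordWt, wt, val, sgn_swap]; ring
  have h₁ : ∑ x, chordWt g x * (hat g [x.2.2.2.2.swap, x.2.1, x.2.2.1] t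
      * hat g [x.1, x.2.2.2.2, x.2.2.2.1, x.2.2.1.swap, x.1.swap, x.2.2.2.1.swap, x.2.1.swap] f)
        = 1 * pairSum g f t [0, 4, 2, 6, 1, 3, 5] :=
    sum_eq_pairSum g f t 1 _ (fun x => (x.1, x.2.2.2.1, x.2.2.2.2, x.2.1.swap, x.2.2.1.swap))
      (fun x => (x.1, x.2.2.2.1.swap, x.2.2.2.2.swap, x.2.1, x.2.2.1))
      (fun x => by simp) (fun x => by simp) fun x => by simp [chordWt, wt, val, sgn_swap]; ring
  have h₂ : ∑ x, chordWt g x * (hat g [x.2.2.2.2.swap, x.2.2.1, x.2.2.2.1] t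
      * hat g [x.1, x.2.1, x.2.2.2.2, x.2.2.1.swap, x.1.swap, x.2.2.2.1.swap, x.2.1.swap] f)
        = 1 * pairSum g f t [0, 2, 4, 5, 1, 6, 3] :=
    sum_eq_pairSum g f t 1 _ (fun x => (x.1, x.2.1, x.2.2.2.2, x.2.2.1.swap, x.2.2.2.1.swap))
      (fun x => (x.1, x.2.1, x.2.2.2.1.swap, x.2.2.2.2.swap, x.2.2.1))
      (fun x => by simp) (fun x => by simp) fun x => by simp [chordWt, wt, val, sgn_swap]; ring
  have h₃ : ∑ x, chordWt g x * (hat g [x.2.2.2.2.swap, x.2.2.2.1, x.2.2.1.swap] t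
      * hat g [x.1, x.2.1, x.2.2.1, x.2.2.2.2, x.1.swap, x.2.2.2.1.swap, x.2.1.swap] f)
        = -1 * pairSum g f t [0, 2, 6, 4, 1, 5, 3] :=
    sum_eq_pairSum g f t (-1) _ (fun x => (x.1, x.2.1, x.2.2.2.2, x.2.2.2.1.swap, x.2.2.1))
      (fun x => (x.1, x.2.1, x.2.2.2.2, x.2.2.2.1.swap, x.2.2.1))
      (fun x => by simp) (fun x => by simp) fun x => by simp [chordWt, wt, val, sgn_swap]; ring
  have h₄ : ∑ x, chordWt g x * (hat g [x.2.2.2.2.swap, x.2.2.1.swap, x.1.swap] t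
      * hat g [x.1, x.2.1, x.2.2.1, x.2.2.2.1, x.2.2.2.2, x.2.2.2.1.swap, x.2.1.swap] f)
        = 1 * pairSum g f t [6, 0, 5, 2, 4, 3, 1] :=
    sum_eq_pairSum g f t 1 _ (fun x => (x.2.1, x.2.2.2.1, x.2.2.2.2, x.2.2.1, x.1))
      (fun x => (x.2.2.2.2, x.1, x.2.2.2.1, x.2.1, x.2.2.1))
      (fun x => by simp) (fun x => by simp) fun x => by simp [chordWt, wt, val]; ring
  have h₅ : ∑ x, chordWt g x * (hat g [x.2.2.2.2.swap, x.1.swap, x.2.2.2.1.swap] t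
      * hat g [x.1, x.2.1, x.2.2.1, x.2.2.2.1, x.2.2.1.swap, x.2.2.2.2, x.2.1.swap] f)
        = 1 * pairSum g f t [5, 0, 2, 6, 3, 4, 1] :=
    sum_eq_pairSum g f t 1 _ (fun x => (x.2.1, x.2.2.1, x.2.2.2.2, x.1, x.2.2.2.1))
      (fun x => (x.2.2.2.1, x.1, x.2.1, x.2.2.2.2, x.2.2.1))
      (fun x => by simp) (fun x => by simp) fun x => by simp [chordWt, wt, val]; ring
  have h₆ : ∑ x, chordWt g x * (hat g [x.2.2.2.2.swap, x.2.2.2.1.swap, x.2.1.swap] t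
      * hat g [x.1, x.2.1, x.2.2.1, x.2.2.2.1, x.2.2.1.swap, x.1.swap, x.2.2.2.2] f)
        = 1 * pairSum g f t [0, 6, 2, 5, 3, 1, 4] :=
    sum_eq_pairSum g f t 1 _ (fun x => (x.1, x.2.2.1, x.2.2.2.2, x.2.2.2.1, x.2.1))
      (fun x => (x.1, x.2.2.2.2, x.2.1, x.2.2.2.1, x.2.2.1))
      (fun x => by simp) (fun x => by simp) fun x => by simp [chordWt, wt, val]; ring
  have h₇ : ∑ x, chordWt g x * (hat g [x.2.2.2.2.swap, x.2.1.swap, x.1] t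
      * hat g [x.2.2.2.2, x.2.1, x.2.2.1, x.2.2.2.1, x.2.2.1.swap, x.1.swap, x.2.2.2.1.swap] f)
        = -1 * pairSum g f t [4, 5, 0, 2, 1, 6, 3] :=
    sum_eq_pairSum g f t (-1) _ (fun x => (x.2.2.1, x.2.2.2.1, x.2.2.2.2, x.2.1, x.1.swap))
      (fun x => (x.2.2.2.2.swap, x.2.2.2.1, x.1, x.2.1, x.2.2.1))
      (fun x => by simp) (fun x => by simp) fun x => by simp [chordWt, wt, val, sgn_swap]; ring
  simp only [Fintype.sum_prod_type, chordWt] at h₀ h₁ h₂ h₃ h₄ h₅ h₆ h₇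
  simp only [chordForm, LinearMap.sum_apply, LinearMap.smul_apply,
    hat_brkH g (fun v => aug_of_mem_LL g _ (hf.1 v)) ht, smul_eq_mul, mul_neg,
    Finset.sum_neg_distrib, Finset.mul_sum, ← mul_assoc _ (sgn g _), mul_add,
    Finset.sum_add_distrib, h₀, h₁, h₂, h₃, h₄, h₅, h₆, h₇]
  simp [evalTerms, brkTerms]
  ring

theorem chordForm_brkH_eq_zero (g : ℕ) {f t : Vs g →ₗ[ℚ] TT g} (hf : f ∈ hh g 5)
    (hd : dvg g f ∈ commSub g) (ht : t ∈ hh g 1) : chordForm g (brkH g f t) = 0 := by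
  rw [chordForm_brkH g hf ht, evalTerms_brkTerms g hf hd ht, neg_zero]

/-! ### Derivations attached to trees -/

/-- The map `H → T` corresponding to `p ⊗ u` under the duality given by the symplectic form. -/
def leafMap (g : ℕ) (p : Ltr g) (u : TT g) : Vs g →ₗ[ℚ] TT g :=
  (sgn g p • coordF g p.swap).smulRight u

theorem leafMap_bas (g : ℕ) (p q : Ltr g) (u : TT g) :
    leafMap g p u (bas g q) = if q = p.swap then sgn g p • u else 0 := by
  simp only [leafMap, coordF, LinearMap.smulRight_apply, LinearMap.smul_apply, LinearMap.proj_apply,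
    bas_apply, smul_eq_mul, mul_ite, mul_one, mul_zero, ite_smul, zero_smul, eq_comm]

theorem leafMap_add (g : ℕ) (p : Ltr g) (u v : TT g) :
    leafMap g p (u + v) = leafMap g p u + leafMap g p v := by
  ext; simp [leafMap]

theorem leafMap_zsmul (g : ℕ) (p : Ltr g) (c : ℤ) (u : TT g) :
    leafMap g p (c • u) = c • leafMap g p u := by
  ext; simp [leafMap]

theorem leafMap_zero (g : ℕ) (p : Ltr g) : leafMap g p 0 = 0 := by
  ext; simp [leafMap]

theorem sympCond_leafMap (g : ℕ) (p : Ltr g) (u : TT g) :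
    sympCond g (leafMap g p u) = ltr g p * u - u * ltr g p := by
  rw [sympCond_eq_sum, Finset.sum_eq_single p.swap (fun q _ hq => by simp [leafMap_bas, hq])
    (by simp), leafMap_bas, if_pos rfl, Sum.swap_swap, smul_mul_assoc, mul_smul_comm, ← smul_sub,
    smul_smul, sgn_swap, neg_mul, sgn_mul_self, neg_one_smul, neg_sub]

theorem dvg_leafMap (g : ℕ) (p : Ltr g) (u : TT g) :
    dvg g (leafMap g p u) = sgn g p • fstRem g p.swap u := by
  rw [dvg, Finset.sum_eq_single p.swap (fun q _ hq => by simp [leafMap_bas, hq]) (by simp),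
    leafMap_bas, if_pos rfl, map_smul]

theorem hat_leafMap (g : ℕ) (p q : Ltr g) (w : List (Ltr g)) (u : TT g) :
    hat g (q :: w) (leafMap g p u) = if q = p then -coef g w u else 0 := by
  rw [hat_cons, leafMap_bas]
  by_cases h : q = p
  · rw [h, if_pos rfl, if_pos rfl, map_smul, smul_eq_mul, ← mul_assoc, sgn_swap, neg_mul,
      sgn_mul_self, neg_one_mul]
  · rw [if_neg h, if_neg fun h' => h (by simpa using congrArg Sum.swap h'), map_zero, mul_zero]

theorem coef_word (g : ℕ) (v w : List (Ltr g)) :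
    coef g v (word g w) = if v = w then 1 else 0 := by
  induction v generalizing w with
  | nil =>
    cases w with
    | nil => simp [coef_nil, word]
    | cons q w => simp [coef_nil, word_cons, aug_ltr]
  | cons p v ih =>
    cases w with
    | nil =>
      have h := fstRem_algebraMap g p 1
      rw [map_one] at h
      simp [coef_cons, word, h]
    | cons q w =>
      rw [coef_cons, word_cons, fstRem_ltr_mul, apply_ite (coef g v), ih, map_zero]
      simp [ite_and]

/-- Planar binary rooted trees with leaves labelled by `α`. -/
inductive LTree (α : Type) : Type
  | leaf : α → LTree α
  | node : LTree α → LTree α → LTree α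

namespace LTree

/-- The number of leaves. -/
def size {α : Type} : LTree α → ℕ
  | leaf _ => 1
  | node x y => x.size + y.size

variable {α : Type} (g : ℕ) (e : α → Ltr g)

/-- The iterated commutator encoded by a tree. -/
def eval : LTree α → TT g
  | leaf p => ltr g (e p)
  | node x y => x.eval * y.eval - y.eval * x.eval

/-- The sum over the leaves of a tree of the maps obtained by rerooting the tree at that leaf, with
`u` inserted at the old root. -/
def reroot : LTree α → TT g → (Vs g →ₗ[ℚ] TT g)
  | leaf p, u => leafMap g (e p) u
  | node x y, u => x.reroot (y.eval g e * u - u * y.eval g e)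
      + y.reroot (u * x.eval g e - x.eval g e * u)

theorem eval_mem_LL (t : LTree α) : t.eval g e ∈ LL g t.size := by
  induction t with
  | leaf p => exact ι_mem_LL g _
  | node x y hx hy => exact brk_mem_LL g _ _ hx hy

theorem reroot_mem (t : LTree α) {k : ℕ} {u : TT g} {n : ℕ} (hu : u ∈ LL g k)
    (h : k + t.size = n + 1) : t.reroot g e u ∈ homInto g (LL g n) := by
  induction t generalizing k u with
  | leaf p =>
    obtain rfl : k = n := by simpa [size] using h
    intro v
    exact Submodule.smul_mem _ _ hu
  | node x y hx hy =>
    rw [size] at h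
    exact add_mem (hx (brk_mem_LL g _ _ (y.eval_mem_LL g e) hu) (by omega))
      (hy (brk_mem_LL g _ _ hu (x.eval_mem_LL g e)) (by omega))

theorem sympCond_reroot (t : LTree α) (u : TT g) :
    sympCond g (t.reroot g e u) = t.eval g e * u - u * t.eval g e := by
  induction t generalizing u with
  | leaf p => exact sympCond_leafMap g _ u
  | node x y hx hy =>
    rw [reroot, map_add, hx, hy, eval]
    noncomm_ring

/-- The symplectic derivation attached to the tree obtained by joining two roots. -/
def join (l r : LTree α) : Vs g →ₗ[ℚ] TT g := l.reroot g e (r.eval g e) + r.reroot g e (l.eval g e)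

theorem join_mem_hh (l r : LTree α) {n : ℕ} (h : l.size + r.size = n + 2) :
    join g e l r ∈ hh g n := by
  refine ⟨add_mem (l.reroot_mem g e (r.eval_mem_LL g e) (by omega))
    (r.reroot_mem g e (l.eval_mem_LL g e) (by omega)), ?_⟩
  rw [SetLike.mem_coe, LinearMap.mem_ker, join, map_add, sympCond_reroot, sympCond_reroot]
  abel

end LTree

/-! ### Expansion of trees into words -/

/-- The product of formal combinations of words. -/
def mulTerms {n : ℕ} (A B : Terms n) : Terms n :=
  A.flatMap fun x => B.map fun y => (x.1 * y.1, x.2 ++ y.2)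

/-- The commutator of formal combinations of words. -/
def brTerms {n : ℕ} (A B : Terms n) : Terms n :=
  mulTerms A B ++ (mulTerms B A).map fun x => (-1 * x.1, x.2)

namespace LTree

/-- The expansion of the iterated commutator encoded by a tree. -/
def terms {n : ℕ} : LTree (Fin n) → Terms n
  | leaf p => [(1, [p])]
  | node x y => brTerms x.terms y.terms

/-- The expansion of `LTree.reroot`; the first letter of a word encodes the argument. -/
def rerootTerms {n : ℕ} : LTree (Fin n) → Terms n → Terms n
  | leaf p, U => U.map fun x => (x.1, p :: x.2)
  | node x y, U => x.rerootTerms (brTerms y.terms U) ++ y.rerootTerms (brTerms U x.terms)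

/-- The expansion of `LTree.join`. -/
def joinTerms {n : ℕ} (l r : LTree (Fin n)) : Terms n :=
  l.rerootTerms r.terms ++ r.rerootTerms l.terms

end LTree

section Expansion

variable {n : ℕ} (g : ℕ) (e : Fin n → Ltr g)

/-- A word in the alphabet `Fin n` as an element of the tensor algebra. -/
def relWord (w : List (Fin n)) : TT g := word g (w.map e)

/-- A word in the alphabet `Fin n` as a map `H → T`. -/
def wordMap : List (Fin n) → (Vs g →ₗ[ℚ] TT g)
  | [] => 0
  | p :: w => leafMap g (e p) (relWord g e w)

theorem evalTerms_mulTerms (A B : Terms n) :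
    evalTerms (relWord g e) (mulTerms A B)
      = evalTerms (relWord g e) A * evalTerms (relWord g e) B := by
  induction A with
  | nil => simp [mulTerms, evalTerms]
  | cons x A ih =>
    have h : evalTerms (relWord g e) (B.map fun y => (x.1 * y.1, x.2 ++ y.2))
        = (x.1 • relWord g e x.2) * evalTerms (relWord g e) B := by
      rw [evalTerms, evalTerms, ← List.sum_map_mul_left, List.map_map]
      refine congrArg List.sum (List.map_congr_left fun y _ => ?_)
      rw [smul_mul_smul_comm, Function.comp_apply, relWord, List.map_append, word_append]
      rfl
    rw [evalTerms_cons, add_mul, ← ih, ← h, ← evalTerms_append]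
    rfl

theorem evalTerms_brTerms (A B : Terms n) :
    evalTerms (relWord g e) (brTerms A B)
      = evalTerms (relWord g e) A * evalTerms (relWord g e) B
        - evalTerms (relWord g e) B * evalTerms (relWord g e) A := by
  rw [brTerms, evalTerms_append, evalTerms_scale, evalTerms_mulTerms, evalTerms_mulTerms,
    neg_one_smul, sub_eq_add_neg]

namespace LTree

theorem evalTerms_terms (t : LTree (Fin n)) : evalTerms (relWord g e) t.terms = t.eval g e := by
  induction t with
  | leaf p => simp [terms, eval, evalTerms, relWord, word]
  | node x y hx hy => rw [terms, evalTerms_brTerms, hx, hy, eval]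

theorem evalTerms_rerootTerms (t : LTree (Fin n)) (U : Terms n) :
    evalTerms (wordMap g e) (t.rerootTerms U) = t.reroot g e (evalTerms (relWord g e) U) := by
  induction t generalizing U with
  | leaf p =>
    rw [rerootTerms, reroot]
    induction U with
    | nil => exact (leafMap_zero g _).symm
    | cons x U ih => rw [List.map_cons, evalTerms_cons, evalTerms_cons, ih, leafMap_add,
        leafMap_zsmul, wordMap]
  | node x y hx hy =>
    rw [rerootTerms, evalTerms_append, hx, hy, evalTerms_brTerms, evalTerms_brTerms,
      evalTerms_terms, evalTerms_terms, reroot]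

theorem evalTerms_joinTerms (l r : LTree (Fin n)) :
    evalTerms (wordMap g e) (joinTerms l r) = join g e l r := by
  rw [joinTerms, evalTerms_append, evalTerms_rerootTerms, evalTerms_rerootTerms, evalTerms_terms,
    evalTerms_terms, join]

end LTree

end Expansion

/-! ### The witness -/

/-- The dual letter in the alphabet `a₁, b₁, a₂, b₂`. -/
def dualLetter : Fin 4 → Fin 4 := ![1, 0, 3, 2]

/-- The sign of a letter in the alphabet `a₁, b₁, a₂, b₂`. -/
def signLetter : Fin 4 → ℤ := ![1, -1, 1, -1]

/-- Contract the first two letters of each word. -/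
def contractTerms : Terms 4 → Terms 4
  | [] => []
  | (c, p :: q :: w) :: L =>
    if q = dualLetter p then (c * signLetter p, w) :: contractTerms L else contractTerms L
  | _ :: L => contractTerms L

/-- The cyclic symmetries of words. -/
def rotateMove (k : ℕ) : Move 4 := fun w => (1, w.rotate k)

/-- The signed reversal of words. -/
def reverseMove : Move 4 := fun w => (-1, w.reverse)

/-- The signed dihedral symmetries of words of length six. -/
def dihedralMoves : List (Move 4) :=
  (List.range 6).map rotateMove ++ (List.range 6).map fun k => compMove reverseMove (rotateMove k)

/-- The value of `chordForm` on a word. -/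
def chordVal : List (Fin 4) → ℤ
  | [a, b, c, d, c', a', d', b'] =>
    if c' = dualLetter c ∧ a' = dualLetter a ∧ d' = dualLetter d ∧ b' = dualLetter b then
      -(signLetter a * signLetter b * signLetter c * signLetter d) else 0
  | _ => 0

section Trees

open LTree

/-- A combination of pairs of trees. -/
def witnessTrees : List (ℤ × LTree (Fin 4) × LTree (Fin 4)) :=
  let x (p : Fin 4) (t : LTree (Fin 4)) : LTree (Fin 4) := node (leaf p) t
  let b₁ : LTree (Fin 4) := leaf 1
  let a₂ : LTree (Fin 4) := leaf 2
  let b₂ : LTree (Fin 4) := leaf 3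
  [(1, x 0 b₂, x 1 (x 0 (x 2 (x 3 (x 1 a₂))))),
   (1, x 0 b₂, x 0 (x 3 (x 1 (x 2 (x 1 a₂))))),
   (1, node (x 0 b₂) a₂, node (x 0 b₁) (x 3 (x 1 a₂))),
   (-1, node (x 0 b₂) b₁, node (x 2 b₂) (x 0 (x 1 a₂))),
   (2, x 0 a₂, x 3 (x 2 (x 1 (x 0 (x 1 b₂)))))]

/-- The expansion of the witness into words. -/
def witnessTerms : Terms 4 :=
  witnessTrees.flatMap fun x => (joinTerms x.2.1 x.2.2).map fun y => (x.1 * y.1, y.2)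

set_option maxRecDepth 100000 in
theorem normTerms_contractTerms_witnessTerms :
    ((normTerms dihedralMoves (contractTerms witnessTerms)).all fun x => x.1 == 0) = true := by
  decide +kernel

set_option maxRecDepth 100000 in
theorem chordVal_witnessTerms : evalTerms chordVal witnessTerms ≠ 0 := by
  decide +kernel

end Trees

/-- The symplectic letters `a₁, b₁, a₂, b₂`. -/
def letterEmb {g : ℕ} (hg : 2 ≤ g) : Fin 4 → Ltr g :=
  ![Sum.inl ⟨0, by omega⟩, Sum.inr ⟨0, by omega⟩, Sum.inl ⟨1, by omega⟩, Sum.inr ⟨1, by omega⟩]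

section Witness

variable {g : ℕ} (hg : 2 ≤ g)

theorem letterEmb_injective : Function.Injective (letterEmb hg) := by
  intro p q h
  fin_cases p <;> fin_cases q <;> simp [letterEmb] at h ⊢

theorem swap_letterEmb (p : Fin 4) : (letterEmb hg p).swap = letterEmb hg (dualLetter p) := by
  fin_cases p <;> rfl

theorem sgn_letterEmb (p : Fin 4) : sgn g (letterEmb hg p) = signLetter p := by
  fin_cases p <;> simp [letterEmb, signLetter, sgn]

/-- The class of a word in `H^{⊗6}/W`. -/
def wordClass (w : List (Fin 4)) : (⨂[ℚ]^6 (Vs g)) ⧸ Wsub g :=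
  (Wsub g).mkQ (degComp g 6 (relWord g (letterEmb hg) w))

theorem wordClass_rotate (w : List (Fin 4)) (k : ℕ) :
    wordClass hg (w.rotate k) = wordClass hg w := by
  induction k generalizing w with
  | zero => rw [List.rotate_zero]
  | succ k ih =>
    cases w with
    | nil => rw [List.rotate_nil]
    | cons p w =>
      rw [List.rotate_cons_succ, ih, wordClass, wordClass, ← sub_eq_zero, ← map_sub,
        Submodule.mkQ_apply, Submodule.Quotient.mk_eq_zero, relWord, relWord, List.map_append,
        List.map_singleton, List.map_cons, ← degComp_word_rotate]
      exact Submodule.subset_span (Or.inl ⟨_, rfl⟩)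

theorem wordClass_reverse (w : List (Fin 4)) :
    wordClass hg w.reverse = -wordClass hg w := by
  rw [wordClass, wordClass, ← sub_eq_zero, sub_neg_eq_add, add_comm, ← map_add,
    Submodule.mkQ_apply, Submodule.Quotient.mk_eq_zero, relWord, relWord, List.map_reverse,
    ← degComp_word_reverse]
  exact Submodule.subset_span (Or.inr ⟨_, rfl⟩)

theorem isSymm_dihedralMoves : ∀ a ∈ dihedralMoves, IsSymm (wordClass hg) a := by
  have hrot : ∀ k, IsSymm (wordClass hg) (rotateMove k) := fun k w => by
    simp [rotateMove, wordClass_rotate]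
  have hrev : IsSymm (wordClass hg) reverseMove := fun w => by
    simp [reverseMove, wordClass_reverse]
  intro a ha
  obtain h | h := List.mem_append.1 ha
  · obtain ⟨k, -, rfl⟩ := List.mem_map.1 h
    exact hrot k
  · obtain ⟨k, -, rfl⟩ := List.mem_map.1 h
    exact hrev.comp _ (hrot k)

theorem map_evalTerms {n : ℕ} {M N : Type*} [AddCommGroup M] [AddCommGroup N] (φ : M →+ N)
    (E : List (Fin n) → M) (L : Terms n) :
    φ (evalTerms E L) = evalTerms (fun w => φ (E w)) L := by
  simp [evalTerms, map_list_sum, Function.comp_def]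

theorem ESfull_wordMap (p q : Fin 4) (w : List (Fin 4)) :
    ESfull g (wordMap g (letterEmb hg) (p :: q :: w))
      = if q = dualLetter p then signLetter p • wordClass hg w else 0 := by
  rw [ESfull_eq, wordMap, dvg_leafMap, relWord, List.map_cons, word_cons, fstRem_ltr_mul,
    swap_letterEmb, sgn_letterEmb]
  simp only [(letterEmb_injective hg).eq_iff, eq_comm (a := q)]
  split_ifs
  · rw [map_smul, map_smul, Int.cast_smul_eq_zsmul]
    rfl
  · simp

theorem ESfull_wordMap_singleton (p : Fin 4) :
    ESfull g (wordMap g (letterEmb hg) [p]) = 0 := by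
  have h := fstRem_algebraMap g (letterEmb hg p).swap 1
  rw [map_one] at h
  rw [ESfull_eq, wordMap, dvg_leafMap]
  simp [relWord, word, h]

theorem ESfull_evalTerms (L : Terms 4) :
    ESfull g (evalTerms (wordMap g (letterEmb hg)) L)
      = evalTerms (wordClass hg) (contractTerms L) := by
  induction L with
  | nil => exact map_zero _
  | cons x L ih =>
    rw [evalTerms_cons, map_add, ih, map_zsmul]
    match x with
    | (c, []) => simp [contractTerms, wordMap]
    | (c, [p]) => simp [contractTerms, ESfull_wordMap_singleton]
    | (c, p :: q :: w) =>
      rw [ESfull_wordMap, contractTerms]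
      split_ifs
      · rw [evalTerms_cons, mul_smul]
      · rw [smul_zero, zero_add]

theorem hat_wordMap (v : List (Ltr g)) (w : List (Fin 4)) (hv : v ≠ []) :
    hat g v (wordMap g (letterEmb hg) w) = if v = w.map (letterEmb hg) then -1 else 0 := by
  cases v with
  | nil => exact absurd rfl hv
  | cons q v =>
    cases w with
    | nil => simp [wordMap]
    | cons p w =>
      rw [wordMap, hat_leafMap, relWord, coef_word]
      by_cases h : v = w.map (letterEmb hg) <;> simp [h]

theorem chordForm_wordMap (w : List (Fin 4)) :
    chordForm g (wordMap g (letterEmb hg) w) = chordVal w := by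
  simp only [chordForm, LinearMap.sum_apply, LinearMap.smul_apply, smul_eq_mul,
    hat_wordMap hg _ w (List.cons_ne_nil _ _)]
  unfold chordVal
  split
  · rename_i a b c d c' a' d' b'
    simp only [List.map_cons, List.map_nil, List.cons.injEq, and_true]
    rw [Finset.sum_eq_single (letterEmb hg a) (fun p _ hp => by simp [hp]) (by simp),
      Finset.sum_eq_single (letterEmb hg b) (fun p _ hp => by simp [hp]) (by simp),
      Finset.sum_eq_single (letterEmb hg c) (fun p _ hp => by simp [hp]) (by simp),
      Finset.sum_eq_single (letterEmb hg d) (fun p _ hp => by simp [hp]) (by simp)]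
    simp only [swap_letterEmb, (letterEmb_injective hg).eq_iff, sgn_letterEmb, true_and,
      eq_comm (a := dualLetter _)]
    split_ifs <;> simp
  · rename_i h
    have hw : w.length ≠ 8 := fun hw => by
      match w, hw with
      | [a, b, c, d, c', a', d', b'], _ => exact h _ _ _ _ _ _ _ _ rfl
    rw [Int.cast_zero]
    refine Finset.sum_eq_zero fun p _ => Finset.sum_eq_zero fun q _ =>
      Finset.sum_eq_zero fun r _ => Finset.sum_eq_zero fun s _ => ?_
    rw [if_neg fun h' => hw (by simpa using (congrArg List.length h').symm), mul_zero]

/-- An element of `𝔥(6) ∩ Ker ES` outside of `𝔪(6)`. -/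
def witness : Vs g →ₗ[ℚ] TT g := evalTerms (wordMap g (letterEmb hg)) witnessTerms

theorem witness_mem_hh : witness hg ∈ hh g 6 := by
  have h : ∀ x ∈ witnessTrees, x.2.1.size + x.2.2.size = 6 + 2 := by
    simp [witnessTrees, LTree.size]
  rw [witness, witnessTerms]
  generalize witnessTrees = L at h
  induction L with
  | nil => exact zero_mem _
  | cons x L ih =>
    rw [List.flatMap_cons, evalTerms_append, evalTerms_scale, LTree.evalTerms_joinTerms]
    exact add_mem (zsmul_mem (LTree.join_mem_hh g _ _ _ (h x (by simp))) _)
      (ih fun y hy => h y (List.mem_cons_of_mem _ hy))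

theorem ESfull_witness : ESfull g (witness hg) = 0 := by
  rw [witness, ESfull_evalTerms]
  exact evalTerms_eq_zero _ (isSymm_dihedralMoves hg) _ normTerms_contractTerms_witnessTerms

theorem chordForm_witness : chordForm g (witness hg) ≠ 0 := by
  have h := map_evalTerms (chordForm g).toAddMonoidHom (wordMap g (letterEmb hg)) witnessTerms
  have h' := map_evalTerms (Int.castAddHom ℚ) chordVal witnessTerms
  simp only [LinearMap.toAddMonoidHom_coe, chordForm_wordMap, Int.coe_castAddHom] at h h'
  rw [witness, h, ← h', Int.cast_ne_zero]
  exact chordVal_witnessTerms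

end Witness

/-! ### The strict inclusion -/

theorem dvg_iterated_mem_comm (g : ℕ) {f₁ f₂ f₃ f₄ f₅ : Vs g →ₗ[ℚ] TT g} (h₁ : f₁ ∈ hh g 1)
    (h₂ : f₂ ∈ hh g 1) (h₃ : f₃ ∈ hh g 1) (h₄ : f₄ ∈ hh g 1) (h₅ : f₅ ∈ hh g 1) :
    brkH g (brkH g (brkH g (brkH g f₁ f₂) f₃) f₄) f₅ ∈ hh g 5 ∧
      dvg g (brkH g (brkH g (brkH g (brkH g f₁ f₂) f₃) f₄) f₅) ∈ commSub g := by
  have step : ∀ n {f t : Vs g →ₗ[ℚ] TT g}, f ∈ hh g (n + 1) ∧ dvg g f ∈ commSub g →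
      t ∈ hh g 1 → brkH g f t ∈ hh g (n + 1 + 1) ∧ dvg g (brkH g f t) ∈ commSub g :=
    fun n f t hf ht => ⟨brkH_mem_hh g _ _ hf.1 ht,
      dvg_brkH_mem_comm g n hf.1 ht (Submodule.mem_sup_right hf.2)⟩
  exact step 3 (step 2 (step 1 ⟨brkH_mem_hh g 1 1 h₁ h₂, dvg_brkH_mem_comm g 0 h₁ h₂
    (Submodule.mem_sup_left (dvg_mem_range_ι g h₁))⟩ h₃) h₄) h₅

theorem mm6_le_kerES (g : ℕ) : mm6 g ≤ kerES g := by
  refine Submodule.span_le.2 ?_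
  rintro _ ⟨f₁, h₁, f₂, h₂, f₃, h₃, f₄, h₄, f₅, h₅, f₆, h₆, rfl⟩
  obtain ⟨h, hd⟩ := dvg_iterated_mem_comm g h₁ h₂ h₃ h₄ h₅
  exact ⟨brkH_mem_hh g 5 1 h h₆,
    ESfull_eq_zero g (dvg_brkH_mem_comm g 4 h h₆ (Submodule.mem_sup_right hd))⟩

theorem mm6_le_ker_chordForm (g : ℕ) : mm6 g ≤ LinearMap.ker (chordForm g) := by
  refine Submodule.span_le.2 ?_
  rintro _ ⟨f₁, h₁, f₂, h₂, f₃, h₃, f₄, h₄, f₅, h₅, f₆, h₆, rfl⟩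
  obtain ⟨h, hd⟩ := dvg_iterated_mem_comm g h₁ h₂ h₃ h₄ h₅
  exact chordForm_brkH_eq_zero g h hd h₆

/-- In degree 6 the Enomoto–Satoh trace (the 1-loop trace) is not injective on the
Johnson cokernel: stably, `𝔪(6) ⊊ 𝔥(6) ∩ Ker ES`. -/
theorem m6_strictly_contained_in_kernel_of_ES :
    ∃ G : ℕ, 1 ≤ G ∧ ∀ g : ℕ, G ≤ g → mm6 g < kerES g := by
  refine ⟨2, one_le_two, fun g hg => (mm6_le_kerES g).lt_of_not_ge fun h => ?_⟩
  exact chordForm_witness hg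
    (mm6_le_ker_chordForm g (h ⟨witness_mem_hh hg, ESfull_witness hg⟩))
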